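/- arXiv:1810.03112 — 3 statements merged into one kernel-verified Lean document; each statement's English description precedes it below -/
import Mathlib

section
/- Let λ > 0. Then there exists a complex-valued solution θ of the Schrödinger equation with spectral parameter λ on [0,∞) such that θ(x)·exp(−iΦ(x,λ)) → K(λ) and θ'(x)·exp(−iΦ(x,λ)) → i√(λ/p₀)·K(λ) as x → ∞. -/
open MeasureTheory Filter Set Complex

noncomputable section

/-- The principal-branch square root `ω(x,z) = ((q x − z)/p x)^{1/2}`. -/
def omg (p q : ℝ → ℝ) (z : ℂ) (x : ℝ) : ℂ :=
  (((q x : ℂ) - z) / (p x : ℂ)) ^ (1 / 2 : ℂ)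

/-- `Ω(x,z) = ∫₀ˣ ω(y,z) dy`. -/
def Omg (p q : ℝ → ℝ) (z : ℂ) (x : ℝ) : ℂ :=
  ∫ y in (0:ℝ)..x, omg p q z y

/-- `a(x,z) = exp(−Ω(x,z))`. -/
def aa (p q : ℝ → ℝ) (z : ℂ) (x : ℝ) : ℂ :=
  Complex.exp (-(Omg p q z x))

/-- Assumption (PQ): `p > 0` on `[0,∞)`, locally absolutely continuous with integrable
derivative `p'` and limit `p₀ > 0` at `+∞`; `q` integrable on `(0,x₀)`, locally absolutely
continuous on `[x₀,∞)` with integrable derivative `q'` there, and `q → 0` at `+∞`.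
Absolute continuity is encoded by the fundamental theorem of calculus representation. -/
structure PQData (p p' q q' : ℝ → ℝ) (p₀ x₀ : ℝ) : Prop where
  p_pos : ∀ x : ℝ, 0 ≤ x → 0 < p x
  hp₀ : 0 < p₀
  hx₀ : 0 ≤ x₀
  p_ac : ∀ x : ℝ, 0 ≤ x → p x = p 0 + ∫ t in (0:ℝ)..x, p' t
  p'_int : IntegrableOn p' (Ioi (0:ℝ))
  p_lim : Tendsto p atTop (nhds p₀)
  q_int : IntegrableOn q (Ioo (0:ℝ) x₀)
  q_ac : ∀ x : ℝ, x₀ ≤ x → q x = q x₀ + ∫ t in x₀..x, q' t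
  q'_int : IntegrableOn q' (Ioi x₀)
  q_lim : Tendsto q atTop (nhds (0:ℝ))

/-- `f` (with derivative `f'`) solves `−(p f')' + q f = z f` on `I`:
`f` is differentiable on `I` with derivative `f'`, and `p·f'` is locally absolutely
continuous on `I` with a.e. derivative `(q − z)·f` (encoded via the FTC representation). -/
def IsSol (p q : ℝ → ℝ) (z : ℂ) (I : Set ℝ) (f f' : ℝ → ℂ) : Prop :=
  (∀ x ∈ I, HasDerivWithinAt f (f' x) I x) ∧
    ∀ x ∈ I, ∀ y ∈ I,
      (p y : ℂ) * f' y - (p x : ℂ) * f' x = ∫ t in x..y, ((q t : ℂ) - z) * f t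

/-- `ε(x) = ∫ₓ^∞ (|p'| + |q'|)`. -/
def eps (p' q' : ℝ → ℝ) (x : ℝ) : ℝ :=
  ∫ y in Ioi x, (|p' y| + |q' y|)

/-- The Volterra kernel `G(x,y,z) = a(y,z)² ∫ₓ^y p(s)⁻¹ a(s,z)⁻² ds`. -/
def Gker (p q : ℝ → ℝ) (z : ℂ) (x y : ℝ) : ℂ :=
  aa p q z y ^ 2 * ∫ s in x..y, ((p s : ℂ))⁻¹ * (aa p q z s ^ 2)⁻¹

/-- `Φ(x,λ) = ∫₀ˣ √(max((λ − q)/p, 0))`. -/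
def Phi (p q : ℝ → ℝ) (lam x : ℝ) : ℝ :=
  ∫ y in (0:ℝ)..x, Real.sqrt (max ((lam - q y) / p y) 0)

/-- `K(λ) = exp(−∫₀^∞ √(max((q − λ)/p, 0)))`. -/
def Kc (p q : ℝ → ℝ) (lam : ℝ) : ℝ :=
  Real.exp (-∫ y in Ioi (0:ℝ), Real.sqrt (max ((q y - lam) / p y) 0))

/-- `ξ(x) = θ(x)·∫_ϱ^x θ(y)⁻² p(y)⁻¹ dy`. -/
def xiFun (p : ℝ → ℝ) (θ : ℝ → ℂ) (ϱ x : ℝ) : ℂ :=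
  θ x * ∫ y in ϱ..x, (θ y ^ 2)⁻¹ * ((p y : ℂ))⁻¹

/-- The derivative of `ξ`: `ξ'(x) = θ'(x)·∫_ϱ^x θ⁻² p⁻¹ + θ(x)⁻¹ p(x)⁻¹`. -/
def xiFun' (p : ℝ → ℝ) (θ θ' : ℝ → ℂ) (ϱ x : ℝ) : ℂ :=
  θ' x * (∫ y in ϱ..x, (θ y ^ 2)⁻¹ * ((p y : ℂ))⁻¹) + (θ x)⁻¹ * ((p x : ℂ))⁻¹


/-! ### Absolutely continuous functions with a prescribed a.e. derivative -/

lemma ac_of_dist_le {E F : Type*} [PseudoMetricSpace E] [PseudoMetricSpace F]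
    {f : ℝ → E} {g : ℝ → F} {a b : ℝ} (K : ℝ)
    (hg : AbsolutelyContinuousOnInterval g a b)
    (h : ∀ x ∈ uIcc a b, ∀ y ∈ uIcc a b, dist (f x) (f y) ≤ K * dist (g x) (g y)) :
    AbsolutelyContinuousOnInterval f a b := by
  unfold AbsolutelyContinuousOnInterval at hg ⊢
  have h2 := hg.const_mul K
  rw [mul_zero] at h2
  refine squeeze_zero' (Eventually.of_forall fun t => Finset.sum_nonneg fun i _ => dist_nonneg) ?_ h2
  refine eventually_inf_principal.2 (Eventually.of_forall fun E hE => ?_)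
  rw [Finset.mul_sum]
  refine Finset.sum_le_sum fun i hi => ?_
  have := hE.1 i hi
  exact h _ this.1 _ this.2

lemma ac_const {E : Type*} [PseudoMetricSpace E] (c : E) (a b : ℝ) :
    AbsolutelyContinuousOnInterval (fun _ : ℝ => c) a b :=
  (LipschitzWith.const c).lipschitzOnWith.absolutelyContinuousOnInterval

/-- `f` is absolutely continuous on `[a,b]` with a.e. derivative `g`. -/
def ACD (f g : ℝ → ℂ) (a b : ℝ) : Prop :=
  AbsolutelyContinuousOnInterval f a b ∧ ∀ᵐ x : ℝ, x ∈ Ioo a b → HasDerivAt f (g x) x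

lemma ae_ne (c : ℝ) : ∀ᵐ x : ℝ, x ≠ c := by
  simp [ae_iff]

lemma ACD.of_integral {g : ℝ → ℂ} {a b : ℝ} (hab : a ≤ b)
    (hg : IntervalIntegrable g volume a b) (C : ℂ) :
    ACD (fun x => C + ∫ t in a..x, g t) g a b := by
  constructor
  · refine ac_of_dist_le 1 (hg.norm.absolutelyContinuousOnInterval_intervalIntegral
      (c := a) left_mem_uIcc) ?_
    intro x hx y hy
    have hx' : IntervalIntegrable g volume a x := hg.mono_set (uIcc_subset_uIcc_left hx)
    have hy' : IntervalIntegrable g volume a y := hg.mono_set (uIcc_subset_uIcc_left hy)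
    rw [dist_add_left, dist_eq_norm, dist_eq_norm, one_mul,
      intervalIntegral.integral_interval_sub_left hx' hy',
      intervalIntegral.integral_interval_sub_left hx'.norm hy'.norm, Real.norm_eq_abs]
    exact intervalIntegral.norm_integral_le_abs_integral_norm
  · filter_upwards [hg.ae_hasDerivAt_integral] with x hx hx2
    have := hx (by rw [uIcc_of_le hab]; exact Ioo_subset_Icc_self hx2) a left_mem_uIcc
    exact this.const_add C

lemma ACD.congr {f f2 g : ℝ → ℂ} {a b : ℝ} (hab : a ≤ b) (h : ACD f g a b)
    (he : ∀ x ∈ Icc a b, f2 x = f x) : ACD f2 g a b := by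
  constructor
  · refine ac_of_dist_le 1 h.1 ?_
    rw [uIcc_of_le hab]
    intro x hx y hy
    rw [he x hx, he y hy, one_mul]
  · filter_upwards [h.2] with x hx hx2
    refine (hx hx2).congr_of_eventuallyEq ?_
    filter_upwards [Icc_mem_nhds hx2.1 hx2.2] with y hy using he y hy

lemma ACD.congr_deriv {f g g2 : ℝ → ℂ} {a b : ℝ} (h : ACD f g a b)
    (he : ∀ x ∈ Ioo a b, g2 x = g x) : ACD f g2 a b := by
  refine ⟨h.1, ?_⟩
  filter_upwards [h.2] with x hx hx2
  rw [he x hx2]; exact hx hx2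

lemma ACD.mono {f g : ℝ → ℂ} {a b c d : ℝ} (h : ACD f g a b) (hac : a ≤ c) (hcd : c ≤ d)
    (hdb : d ≤ b) : ACD f g c d := by
  refine ⟨h.1.mono ?_, ?_⟩
  · rw [uIcc_of_le hcd, uIcc_of_le (by linarith)]; exact Icc_subset_Icc hac hdb
  · filter_upwards [h.2] with x hx hx2 using hx (Ioo_subset_Ioo hac hdb hx2)

lemma ACD.const (c : ℂ) (a b : ℝ) : ACD (fun _ => c) (fun _ => 0) a b :=
  ⟨ac_const c a b, Eventually.of_forall fun x _ => hasDerivAt_const x c⟩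

lemma ACD.add {f g f2 g2 : ℝ → ℂ} {a b : ℝ} (h : ACD f g a b) (h2 : ACD f2 g2 a b) :
    ACD (fun x => f x + f2 x) (fun x => g x + g2 x) a b := by
  refine ⟨h.1.add h2.1, ?_⟩
  filter_upwards [h.2, h2.2] with x hx hx2 hI using (hx hI).add (hx2 hI)

lemma ACD.sub {f g f2 g2 : ℝ → ℂ} {a b : ℝ} (h : ACD f g a b) (h2 : ACD f2 g2 a b) :
    ACD (fun x => f x - f2 x) (fun x => g x - g2 x) a b := by
  refine ⟨h.1.sub h2.1, ?_⟩
  filter_upwards [h.2, h2.2] with x hx hx2 hI using (hx hI).sub (hx2 hI)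

lemma ACD.mul {f g f2 g2 : ℝ → ℂ} {a b : ℝ} (h : ACD f g a b) (h2 : ACD f2 g2 a b) :
    ACD (fun x => f x * f2 x) (fun x => g x * f2 x + f x * g2 x) a b := by
  refine ⟨h.1.smul h2.1, ?_⟩
  filter_upwards [h.2, h2.2] with x hx hx2 hI using (hx hI).mul (hx2 hI)

lemma ACD.const_mul {f g : ℝ → ℂ} {a b : ℝ} (c : ℂ) (h : ACD f g a b) :
    ACD (fun x => c * f x) (fun x => c * g x) a b :=
  ((ACD.const c a b).mul h).congr_deriv fun x _ => by simp

lemma ACD.exp {f g : ℝ → ℂ} {a b : ℝ} (h : ACD f g a b) :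
    ACD (fun x => Complex.exp (f x)) (fun x => Complex.exp (f x) * g x) a b := by
  constructor
  · obtain ⟨C, hC⟩ := h.1.exists_bound
    have hcd : ContDiffOn ℝ 1 Complex.exp (Metric.closedBall (0:ℂ) C) :=
      (Complex.contDiff_exp (𝕜 := ℝ)).contDiffOn
    obtain ⟨K, hK⟩ := hcd.exists_lipschitzOnWith (by decide) (convex_closedBall _ _)
      (isCompact_closedBall _ _)
    refine ac_of_dist_le K h.1 fun x hx y hy => ?_
    exact hK.dist_le_mul _ (by simpa using hC x hx) _ (by simpa using hC y hy)
  · filter_upwards [h.2] with x hx hI using (hx hI).cexp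

lemma ACD.ftc {f g : ℝ → ℂ} {a b : ℝ} (hab : a ≤ b) (h : ACD f g a b)
    (hg : IntervalIntegrable g volume a b) : ∫ x in a..b, g x = f b - f a := by
  have h2 := h.sub (ACD.of_integral hab hg 0)
  obtain ⟨C, hC⟩ := h2.1.const_of_ae_hasDerivAt_zero (by
    filter_upwards [h2.2, ae_ne a, ae_ne b] with x hx ha hb hI
    rw [uIcc_of_le hab] at hI
    simpa using hx ⟨lt_of_le_of_ne hI.1 (Ne.symm ha), lt_of_le_of_ne hI.2 hb⟩)
  have h3 := hC a left_mem_uIcc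
  have h4 := hC b right_mem_uIcc
  simp at h3 h4
  rw [← h3] at h4
  rw [← h4]; ring

lemma ACD.continuousOn {f g : ℝ → ℂ} {a b : ℝ} (hab : a ≤ b) (h : ACD f g a b) :
    ContinuousOn f (Icc a b) := by
  have := h.1.continuousOn
  rwa [uIcc_of_le hab] at this

/-! ### A Volterra equation from infinity -/

lemma continuous_tail {E : Type*} [NormedAddCommGroup E] [NormedSpace ℝ E]
    {F : ℝ → E} (hF : Integrable F) : Continuous fun x : ℝ => ∫ t in Ioi x, F t := by
  have : (fun x : ℝ => ∫ t in Ioi x, F t)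
      = fun x => (∫ t in Ioi (0:ℝ), F t) - ∫ t in (0:ℝ)..x, F t := by
    funext x
    rw [← intervalIntegral.integral_Ioi_sub_Ioi' hF.integrableOn hF.integrableOn]
    abel
  rw [this]
  exact continuous_const.sub
    (intervalIntegral.continuous_primitive (fun a b => hF.intervalIntegrable) 0)

lemma weight_bound {n : ℝ → ℝ} (hn : Integrable n) (x : ℝ) :
    ∫ t in Ioi x, n t * Real.exp (2 * ∫ s in Ioi t, n s) ≤
      Real.exp (2 * ∫ s in Ioi x, n s) / 2 := by
  set N : ℝ → ℝ := fun t => ∫ s in Ioi t, n s with hN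
  have hNc : Continuous N := continuous_tail hn
  have hNb : ∀ t, |N t| ≤ ∫ s, |n s| := fun t =>
    (norm_integral_le_integral_norm _).trans
      (setIntegral_le_integral hn.norm (Eventually.of_forall fun _ => norm_nonneg _))
  have hint : Integrable fun t => n t * Real.exp (2 * N t) := by
    refine hn.mul_bdd (c := Real.exp (2 * ∫ s, |n s|))
      (by fun_prop) (Eventually.of_forall fun t => ?_)
    rw [Real.norm_eq_abs, Real.abs_exp, Real.exp_le_exp]
    have := (abs_le.1 (hNb t)).2
    linarith
  have hfin : ∀ b, x ≤ b → ∫ t in x..b, n t * Real.exp (2 * N t) ≤ Real.exp (2 * N x) / 2 := by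
    intro b hb
    have hnc : Integrable fun t => (n t : ℂ) := hn.ofReal
    have h1 : ACD (fun t => (N t : ℂ)) (fun t => -(n t : ℂ)) x b := by
      have := (ACD.const (N x : ℂ) x b).sub (ACD.of_integral hb (hnc.intervalIntegrable) 0)
      refine (this.congr hb ?_).congr_deriv (fun t _ => by simp)
      intro t ht
      have h3 := intervalIntegral.integral_Ioi_sub_Ioi' (hn.integrableOn (s := Ioi x))
        (hn.integrableOn (s := Ioi t))
      rw [intervalIntegral.integral_ofReal, ← h3]
      simp [hN]
    have h2 := (h1.const_mul 2).exp.ftc hb (by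
      have : Integrable (fun t => ((-2 * (n t * Real.exp (2 * N t)) : ℝ) : ℂ)) :=
        (hint.const_mul (-2)).ofReal
      refine (this.congr (Eventually.of_forall fun t => ?_)).intervalIntegrable
      simp; ring)
    have h4 : ∫ t in x..b, Complex.exp (2 * (N t : ℂ)) * (2 * -(n t : ℂ))
        = ((-2 * ∫ t in x..b, n t * Real.exp (2 * N t) : ℝ) : ℂ) := by
      rw [← intervalIntegral.integral_const_mul, ← intervalIntegral.integral_ofReal]
      congr 1; funext t; simp; ring
    rw [h4] at h2
    have h5 : -2 * ∫ t in x..b, n t * Real.exp (2 * N t)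
        = Real.exp (2 * N b) - Real.exp (2 * N x) := by
      exact_mod_cast h2
    have := Real.exp_pos (2 * N b)
    linarith
  have htend := intervalIntegral_tendsto_integral_Ioi x hint.integrableOn tendsto_id
  refine le_of_tendsto htend ?_
  filter_upwards [eventually_ge_atTop x] with b hb using hfin b hb

lemma volterra {E : Type*} [NormedAddCommGroup E] [NormedSpace ℝ E] [CompleteSpace E]
    {M : ℝ → E →L[ℝ] E} (hM : Integrable M) (c : E) :
    ∃ y : ℝ → E, Continuous y ∧ Integrable (fun t => M t (y t)) ∧
      ∀ x, y x = c - ∫ t in Ioi x, M t (y t) := by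
  set N : ℝ → ℝ := fun t => ∫ s in Ioi t, ‖M s‖ with hN
  have hNc : Continuous N := continuous_tail hM.norm
  have hN0 : ∀ t, 0 ≤ N t := fun t => integral_nonneg fun _ => norm_nonneg _
  have hNb : ∀ t, N t ≤ ∫ s, ‖M s‖ := fun t =>
      (setIntegral_le_integral hM.norm (Eventually.of_forall fun _ => norm_nonneg _))
  set w : ℝ → ℝ := fun t => Real.exp (2 * N t) with hw
  have hwc : Continuous w := by fun_prop
  have hw0 : ∀ t, 0 < w t := fun t => Real.exp_pos _
  have hw1 : ∀ t, 1 ≤ w t := fun t => Real.one_le_exp (by linarith [hN0 t])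
  have hMint : ∀ y : ℝ → E, Continuous y → (∃ C, ∀ t, ‖y t‖ ≤ C) →
      Integrable fun t => M t (y t) := by
    rintro y hy ⟨C, hC⟩
    refine (hM.norm.mul_const C).mono' ?_ (Eventually.of_forall fun t => ?_)
    · exact (ContinuousLinearMap.apply ℝ E).aestronglyMeasurable_comp₂
        hy.aestronglyMeasurable hM.aestronglyMeasurable
    · exact (M t).le_of_opNorm_le_of_le le_rfl (hC t)
  have hwb : ∀ t, w t ≤ Real.exp (2 * ∫ s, ‖M s‖) := fun t =>
    Real.exp_le_exp.2 (by linarith [hNb t])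
  have hwz : ∀ z : BoundedContinuousFunction ℝ E, Integrable fun t => M t (w t • z t) := by
    intro z
    refine hMint _ (hwc.smul z.continuous) ⟨Real.exp (2 * ∫ s, ‖M s‖) * ‖z‖, fun t => ?_⟩
    rw [norm_smul, Real.norm_of_nonneg (hw0 t).le]
    exact mul_le_mul (hwb t) (z.norm_coe_le_norm t) (norm_nonneg _) (Real.exp_pos _).le
  have hbd : ∀ z : BoundedContinuousFunction ℝ E, ∀ x,
      ‖(w x)⁻¹ • (c - ∫ t in Ioi x, M t (w t • z t))‖ ≤ ‖c‖ + ∫ t, ‖M t (w t • z t)‖ := by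
    intro z x
    rw [norm_smul, norm_inv, Real.norm_of_nonneg (hw0 x).le]
    have h1 : (w x)⁻¹ ≤ 1 := inv_le_one_of_one_le₀ (hw1 x)
    have h2 : ‖c - ∫ t in Ioi x, M t (w t • z t)‖ ≤ ‖c‖ + ∫ t, ‖M t (w t • z t)‖ := by
      refine (norm_sub_le _ _).trans (add_le_add le_rfl ?_)
      exact (norm_integral_le_integral_norm _).trans
        (setIntegral_le_integral (hwz z).norm (Eventually.of_forall fun _ => norm_nonneg _))
    calc _ ≤ 1 * ‖c - ∫ t in Ioi x, M t (w t • z t)‖ := by gcongr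
      _ ≤ _ := by rw [one_mul]; exact h2
  let S : BoundedContinuousFunction ℝ E → BoundedContinuousFunction ℝ E := fun z =>
    BoundedContinuousFunction.ofNormedAddCommGroup
      (fun x => (w x)⁻¹ • (c - ∫ t in Ioi x, M t (w t • z t)))
      ((hwc.inv₀ fun x => (hw0 x).ne').smul (continuous_const.sub (continuous_tail (hwz z))))
      _ (hbd z)
  have hS : ContractingWith (1/2) S := by
    refine ⟨by norm_num, LipschitzWith.of_dist_le_mul fun z1 z2 => ?_⟩
    refine (BoundedContinuousFunction.dist_le (by positivity)).2 fun x => ?_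
    show dist ((w x)⁻¹ • (c - ∫ t in Ioi x, M t (w t • z1 t)))
      ((w x)⁻¹ • (c - ∫ t in Ioi x, M t (w t • z2 t))) ≤ _
    rw [dist_smul₀, dist_sub_left, dist_eq_norm,
      ← integral_sub (hwz z1).integrableOn (hwz z2).integrableOn]
    have hwint : Integrable fun t => ‖M t‖ * w t := by
      refine hM.norm.mul_bdd (c := Real.exp (2 * ∫ s, ‖M s‖)) hwc.aestronglyMeasurable
        (Eventually.of_forall fun t => ?_)
      rw [Real.norm_of_nonneg (hw0 t).le]; exact hwb t
    have h1 : ‖∫ t in Ioi x, (M t (w t • z1 t) - M t (w t • z2 t))‖ ≤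
        ∫ t in Ioi x, (‖M t‖ * w t) * dist z1 z2 := by
      refine norm_integral_le_of_norm_le (hwint.mul_const _).integrableOn
        (Eventually.of_forall fun t => ?_)
      rw [← map_sub, ← smul_sub]
      refine ((M t).le_opNorm _).trans ?_
      rw [norm_smul, Real.norm_of_nonneg (hw0 t).le, mul_assoc]
      gcongr
      rw [← dist_eq_norm]; exact BoundedContinuousFunction.dist_coe_le_dist t
    rw [integral_mul_const] at h1
    have h2 := weight_bound hM.norm x
    rw [norm_inv, Real.norm_of_nonneg (hw0 x).le]
    have h3 : ‖∫ t in Ioi x, (M t (w t • z1 t) - M t (w t • z2 t))‖ ≤ w x / 2 * dist z1 z2 :=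
      h1.trans (mul_le_mul_of_nonneg_right h2 dist_nonneg)
    calc _ ≤ (w x)⁻¹ * (w x / 2 * dist z1 z2) := by
            have := hw0 x
            gcongr
      _ = _ := by
            have := (hw0 x).ne'
            simp; field_simp
  obtain ⟨z, hz⟩ : ∃ z, S z = z := ⟨hS.fixedPoint, hS.fixedPoint_isFixedPt⟩
  refine ⟨fun x => w x • z x, hwc.smul z.continuous, hwz z, fun x => ?_⟩
  have h1 : z x = (w x)⁻¹ • (c - ∫ t in Ioi x, M t (w t • z t)) := by
    conv_lhs => rw [← hz]
    rfl
  show w x • z x = _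
  rw [h1, smul_inv_smul₀ (hw0 x).ne']

lemma acd_of_tail {A g : ℝ → ℂ} {A0 : ℂ} (hg : Integrable g)
    (h : ∀ x, A x = A0 - ∫ t in Ioi x, g t) {b : ℝ} (hb : 0 ≤ b) : ACD A g 0 b := by
  refine (ACD.of_integral hb hg.intervalIntegrable (A 0)).congr hb fun x _ => ?_
  rw [h x, h 0, ← intervalIntegral.integral_Ioi_sub_Ioi' hg.integrableOn hg.integrableOn]
  ring

lemma tendsto_of_tail {A g : ℝ → ℂ} {A0 : ℂ}
    (h : ∀ x, A x = A0 - ∫ t in Ioi x, g t) : Tendsto A atTop (nhds A0) := by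
  have : Tendsto (fun x : ℝ => A0 - ∫ t in Ioi x, g t) atTop (nhds (A0 - 0)) :=
    tendsto_const_nhds.sub (tendsto_integral_Ioi_zero tendsto_id)
  rw [sub_zero] at this
  exact this.congr fun x => (h x).symm

lemma volterra2 {a b c d : ℝ → ℂ} (ha : IntegrableOn a (Ioi 0)) (hb : IntegrableOn b (Ioi 0))
    (hc : IntegrableOn c (Ioi 0)) (hd : IntegrableOn d (Ioi 0)) (A0 : ℂ) :
    ∃ A B : ℝ → ℂ, (∀ x, 0 ≤ x → ACD A (fun t => a t * A t + b t * B t) 0 x) ∧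
      (∀ x, 0 ≤ x → ACD B (fun t => c t * A t + d t * B t) 0 x) ∧
      Tendsto A atTop (nhds A0) ∧ Tendsto B atTop (nhds 0) := by
  let e1 : ℂ × ℂ →L[ℝ] ℂ := ContinuousLinearMap.fst ℝ ℂ ℂ
  let e2 : ℂ × ℂ →L[ℝ] ℂ := ContinuousLinearMap.snd ℝ ℂ ℂ
  let i1 : ℂ →L[ℝ] ℂ × ℂ := ContinuousLinearMap.inl ℝ ℂ ℂ
  let i2 : ℂ →L[ℝ] ℂ × ℂ := ContinuousLinearMap.inr ℝ ℂ ℂ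
  let aI := (Ioi (0:ℝ)).indicator a
  let bI := (Ioi (0:ℝ)).indicator b
  let cI := (Ioi (0:ℝ)).indicator c
  let dI := (Ioi (0:ℝ)).indicator d
  have ha' : Integrable aI := (integrable_indicator_iff measurableSet_Ioi).2 ha
  have hb' : Integrable bI := (integrable_indicator_iff measurableSet_Ioi).2 hb
  have hc' : Integrable cI := (integrable_indicator_iff measurableSet_Ioi).2 hc
  have hd' : Integrable dI := (integrable_indicator_iff measurableSet_Ioi).2 hd
  let M : ℝ → (ℂ × ℂ →L[ℝ] ℂ × ℂ) := fun t =>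
    aI t • (i1.comp e1) + bI t • (i1.comp e2) + cI t • (i2.comp e1) + dI t • (i2.comp e2)
  have hM : Integrable M := by
    have h1 : Integrable (fun t => aI t • (i1.comp e1)) := ha'.smul_const _
    have h2 : Integrable (fun t => bI t • (i1.comp e2)) := hb'.smul_const _
    have h3 : Integrable (fun t => cI t • (i2.comp e1)) := hc'.smul_const _
    have h4 : Integrable (fun t => dI t • (i2.comp e2)) := hd'.smul_const _
    have h12 := Integrable.add (f := fun t => aI t • (i1.comp e1)) h1 h2
    have h123 := Integrable.add h12 h3
    exact Integrable.add h123 h4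
  obtain ⟨y, -, hyi, hy⟩ := volterra hM (A0, 0)
  have hM1 : ∀ t, (M t (y t)).1 = aI t * (y t).1 + bI t * (y t).2 := by
    intro t; simp [M, i1, i2, e1, e2]
  have hM2 : ∀ t, (M t (y t)).2 = cI t * (y t).1 + dI t * (y t).2 := by
    intro t; simp [M, i1, i2, e1, e2]
  have hi1 : Integrable fun t => aI t * (y t).1 + bI t * (y t).2 :=
    hyi.fst.congr (Eventually.of_forall hM1)
  have hi2 : Integrable fun t => cI t * (y t).1 + dI t * (y t).2 :=
    hyi.snd.congr (Eventually.of_forall hM2)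
  have h1 : ∀ x, (y x).1 = A0 - ∫ t in Ioi x, (aI t * (y t).1 + bI t * (y t).2) := by
    intro x
    rw [hy x]
    have := e1.integral_comp_comm (hyi.integrableOn (s := Ioi x))
    simp only [e1, ContinuousLinearMap.coe_fst', hM1] at this
    rw [this]; rfl
  have h2 : ∀ x, (y x).2 = 0 - ∫ t in Ioi x, (cI t * (y t).1 + dI t * (y t).2) := by
    intro x
    rw [hy x]
    have := e2.integral_comp_comm (hyi.integrableOn (s := Ioi x))
    simp only [e2, ContinuousLinearMap.coe_snd', hM2] at this
    rw [this]; rfl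
  refine ⟨fun x => (y x).1, fun x => (y x).2, fun x hx => ?_, fun x hx => ?_,
    tendsto_of_tail h1, tendsto_of_tail h2⟩
  · refine (acd_of_tail hi1 h1 hx).congr_deriv fun t ht => ?_
    have : t ∈ Ioi (0:ℝ) := ht.1
    simp only [aI, bI, indicator_of_mem this]
  · refine (acd_of_tail hi2 h2 hx).congr_deriv fun t ht => ?_
    have : t ∈ Ioi (0:ℝ) := ht.1
    simp only [cI, dI, indicator_of_mem this]

/-! ### Assembling the solution -/

lemma ofRealII {f : ℝ → ℝ} {a b : ℝ} (h : IntervalIntegrable f volume a b) :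
    IntervalIntegrable (fun x => (f x : ℂ)) volume a b :=
  ⟨Integrable.ofReal h.1, Integrable.ofReal h.2⟩

lemma core {p q k : ℝ → ℝ} {lam p₀ : ℝ} {R r m s1 s2 : ℝ → ℂ} {μ m0 : ℂ}
    (hpc : ContinuousOn p (Ici 0)) (hp : ∀ x, 0 ≤ x → 0 < p x) (hp₀ : 0 < p₀)
    (hplim : Tendsto p atTop (nhds p₀))
    (hq : ∀ b, 0 ≤ b → IntervalIntegrable q volume 0 b)
    (hk : ∀ b, 0 ≤ b → IntervalIntegrable k volume 0 b)
    (hR : ∀ b, 0 ≤ b → ACD R (fun x => 2 * r x) 0 b) (hr : IntegrableOn r (Ioi 0))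
    (hμ : μ ≠ 0) (hm : ∀ x, m x = μ * Complex.exp (R x))
    (hs1 : ∀ x, s1 x = ((q x : ℂ) - lam + m x * k x) / (2 * I * m x))
    (hs2 : ∀ x, s2 x = I * (m x / p x - k x) / 2)
    (hs1i : IntegrableOn s1 (Ioi 0)) (hs2i : IntegrableOn s2 (Ioi 0))
    (hm0 : m0 ≠ 0) (hmlim : Tendsto m atTop (nhds m0)) (A0 : ℂ) :
    ∃ θ θ' : ℝ → ℂ,
      IsSol p q (lam : ℂ) (Ici 0) θ θ' ∧
      Tendsto (fun x => θ x * Complex.exp (-(Complex.I * ((∫ y in (0:ℝ)..x, k y : ℝ) : ℂ))))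
        atTop (nhds (A0 / (2 * I * m0))) ∧
      Tendsto (fun x => θ' x * Complex.exp (-(Complex.I * ((∫ y in (0:ℝ)..x, k y : ℝ) : ℂ))))
        atTop (nhds (A0 / (2 * p₀))) := by
  set Φ : ℝ → ℝ := fun x => ∫ y in (0:ℝ)..x, k y with hΦ
  have hΦd : ∀ b, 0 ≤ b → ACD (fun x => (Φ x : ℂ)) (fun x => (k x : ℂ)) 0 b := by
    intro b hb
    refine (ACD.of_integral hb (ofRealII (hk b hb)) 0).congr hb fun x _ => ?_
    simp only [hΦ]; rw [zero_add, intervalIntegral.integral_ofReal]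
  set P : ℝ → ℂ := fun x => Complex.exp (I * Φ x) with hP
  set Q : ℝ → ℂ := fun x => Complex.exp (-I * Φ x) with hQ
  have hPQ : ∀ x, P x * Q x = 1 := fun x => by
    simp only [hP, hQ]; rw [← Complex.exp_add]; simp
  have hPn : ∀ x, ‖P x‖ = 1 := fun x => by
    simp only [hP]; rw [mul_comm]; exact Complex.norm_exp_ofReal_mul_I _
  have hQn : ∀ x, ‖Q x‖ = 1 := fun x => by
    have := congrArg norm (hPQ x)
    rw [norm_mul, hPn] at this; simpa using this
  have hPd : ∀ b, 0 ≤ b → ACD P (fun x => P x * (I * k x)) 0 b := fun b hb =>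
    ((hΦd b hb).const_mul I).exp
  have hQd : ∀ b, 0 ≤ b → ACD Q (fun x => Q x * (-I * k x)) 0 b := fun b hb =>
    ((hΦd b hb).const_mul (-I)).exp
  -- measurability of the phases on the half line
  have hcont : ∀ f g : ℝ → ℂ, (∀ b, 0 ≤ b → ACD f g 0 b) → ContinuousOn f (Ici 0) := by
    intro f g h x hx
    have h1 := (h (x+1) (by linarith [mem_Ici.1 hx])).continuousOn (by linarith [mem_Ici.1 hx])
    refine (h1 x ⟨hx, by linarith⟩).mono_of_mem_nhdsWithin ?_
    rw [mem_nhdsWithin]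
    exact ⟨Iio (x+1), isOpen_Iio, by simp, fun y hy => ⟨hy.2, le_of_lt hy.1⟩⟩
  have hbdd : ∀ f g U : ℝ → ℂ, (∀ b, 0 ≤ b → ACD U g 0 b) → (∀ x, ‖U x‖ = 1) →
      IntegrableOn f (Ioi 0) → IntegrableOn (fun x => f x * U x ^ 2) (Ioi 0) := by
    intro f g U hU hn hf
    refine Integrable.mul_bdd (c := 1) hf ?_ (Eventually.of_forall fun x => by simp [hn])
    exact (((hcont U g hU).mono Ioi_subset_Ici_self).pow 2).aestronglyMeasurable measurableSet_Ioi
  obtain ⟨A, B, hA, hB, hAl, hBl⟩ := volterra2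
    (a := fun x => s1 x + r x + s2 x) (b := fun x => (s2 x - (s1 x + r x)) * Q x ^ 2)
    (c := fun x => (s1 x - r x - s2 x) * P x ^ 2) (d := fun x => r x - s1 x - s2 x)
    ((hs1i.add hr).add hs2i) (hbdd _ _ _ hQd hQn (hs2i.sub (hs1i.add hr)))
    (hbdd _ _ _ hPd hPn ((hs1i.sub hr).sub hs2i)) ((hr.sub hs1i).sub hs2i) A0
  have hmne : ∀ x, m x ≠ 0 := fun x => by
    rw [hm]; exact mul_ne_zero hμ (Complex.exp_ne_zero _)
  set θ : ℝ → ℂ := fun x => (2 * I)⁻¹ * (m x)⁻¹ * (A x * P x - B x * Q x) with hθ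
  set v : ℝ → ℂ := fun x => 2⁻¹ * (A x * P x + B x * Q x) with hv
  have hmi : ∀ b, 0 ≤ b → ACD (fun x => (m x)⁻¹) (fun x => -2 * r x * (m x)⁻¹) 0 b := by
    intro b hb
    have := (((hR b hb).const_mul (-1)).exp.const_mul μ⁻¹)
    refine (this.congr hb fun x _ => ?_).congr_deriv fun x _ => ?_
    · rw [hm, mul_inv, ← Complex.exp_neg]; simp
    · rw [hm, mul_inv, ← Complex.exp_neg]; simp; ring
  have hAP : ∀ b : ℝ, 0 ≤ b → _ := fun b hb => (hA b hb).mul (hPd b hb)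
  have hBQ : ∀ b : ℝ, 0 ≤ b → _ := fun b hb => (hB b hb).mul (hQd b hb)
  have hpne : ∀ x, 0 ≤ x → (p x : ℂ) ≠ 0 := fun x hx => by
    exact_mod_cast (hp x hx).ne'
  have hθd : ∀ b, 0 ≤ b → ACD θ (fun x => v x / p x) 0 b := by
    intro b hb
    refine (((hmi b hb).const_mul (2 * I)⁻¹).mul ((hAP b hb).sub (hBQ b hb))).congr_deriv
      fun x hx => ?_
    have h1 := hmne x
    have h2 := hpne x hx.1.le
    have h3 : 2 * s2 x + I * k x = I * m x / p x := by
      rw [hs2]; field_simp; ring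
    have h4 : (2 * I)⁻¹ * (m x)⁻¹ * (2 * s2 x + I * k x) = 2⁻¹ / p x := by
      rw [h3]; field_simp
    have h5 := hPQ x
    simp only [hv]
    calc 2⁻¹ * (A x * P x + B x * Q x) / p x = (2⁻¹ / p x) * (A x * P x + B x * Q x) := by ring
      _ = ((2 * I)⁻¹ * (m x)⁻¹ * (2 * s2 x + I * k x)) * (A x * P x + B x * Q x) := by rw [h4]
      _ = _ := by
        linear_combination (-((2 * I)⁻¹ * (m x)⁻¹ * (s2 x - s1 x - r x) * B x * Q x)
          + (2 * I)⁻¹ * (m x)⁻¹ * (s1 x - r x - s2 x) * A x * P x) * h5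
  have hvd : ∀ b, 0 ≤ b → ACD v (fun x => ((q x : ℂ) - lam) * θ x) 0 b := by
    intro b hb
    refine (((hAP b hb).add (hBQ b hb)).const_mul 2⁻¹).congr_deriv fun x hx => ?_
    have h1 := hmne x
    have h4 : 2⁻¹ * (2 * s1 x + I * k x) = ((q x : ℂ) - lam) * ((2 * I)⁻¹ * (m x)⁻¹) := by
      rw [hs1]; field_simp; linear_combination ((k x : ℂ) * m x) * I_sq
    have h5 := hPQ x
    simp only [hθ]
    calc ((q x : ℂ) - lam) * ((2 * I)⁻¹ * (m x)⁻¹ * (A x * P x - B x * Q x))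
        = (((q x : ℂ) - lam) * ((2 * I)⁻¹ * (m x)⁻¹)) * (A x * P x - B x * Q x) := by ring
      _ = (2⁻¹ * (2 * s1 x + I * k x)) * (A x * P x - B x * Q x) := by rw [h4]
      _ = _ := by
        linear_combination (-(2⁻¹ * (s2 x - s1 x - r x) * B x * Q x)
          - 2⁻¹ * (s1 x - r x - s2 x) * A x * P x) * h5
  have hθc := hcont θ _ hθd
  have hvc := hcont v _ hvd
  have hpcc : ContinuousOn (fun x => (p x : ℂ)) (Ici 0) :=
    Complex.continuous_ofReal.comp_continuousOn hpc
  have hvpc : ContinuousOn (fun x => v x / p x) (Ici 0) := hvc.div hpcc hpne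
  have hvint : ∀ b, 0 ≤ b → IntervalIntegrable (fun x => ((q x : ℂ) - lam) * θ x) volume 0 b := by
    intro b hb
    refine IntervalIntegrable.mul_continuousOn ((ofRealII (hq b hb)).sub intervalIntegrable_const) ?_
    rw [uIcc_of_le hb]; exact hθc.mono Icc_subset_Ici_self
  refine ⟨θ, fun x => v x / p x, ⟨?_, ?_⟩, ?_, ?_⟩
  · intro x hx
    have hx0 : (0:ℝ) ≤ x := hx
    have hlt : x < x + 1 := by linarith
    have hii : ∀ b, 0 ≤ b → IntervalIntegrable (fun x => v x / p x) volume 0 b := fun b hb =>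
      (hvpc.mono (by rw [uIcc_of_le hb]; exact Icc_subset_Ici_self)).intervalIntegrable
    have heq : ∀ y ∈ Ici (0:ℝ), θ y = θ 0 + ∫ t in (0:ℝ)..y, v t / p t := fun y hy => by
      rw [(hθd y hy).ftc hy (hii y hy)]; ring
    have hd : HasDerivWithinAt (fun y => ∫ t in (0:ℝ)..y, v t / p t) (v x / p x) (Ici 0) x := by
      have hext : Continuous (fun y => v (max y 0) / p (max y 0)) :=
        hvpc.comp_continuous (continuous_id.max continuous_const) fun y => mem_Ici.2 (le_max_right _ _)
      have h1 := (hext.integral_hasStrictDerivAt 0 x).hasDerivAt.hasDerivWithinAt (s := Ici 0)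
      have h2 : ∀ y ∈ Ici (0:ℝ), ∫ t in (0:ℝ)..y, v t / p t
          = ∫ t in (0:ℝ)..y, v (max t 0) / p (max t 0) := by
        intro y hy
        refine intervalIntegral.integral_congr fun t ht => ?_
        rw [uIcc_of_le hy] at ht
        simp [max_eq_left ht.1]
      rw [max_eq_left hx0] at h1
      exact h1.congr h2 (h2 x hx)
    exact (hd.const_add (θ 0)).congr heq (heq x hx)
  · have key : ∀ y, 0 ≤ y → v y - v 0 = ∫ t in (0:ℝ)..y, ((q t : ℂ) - lam) * θ t := fun y hy =>
      ((hvd y hy).ftc hy (hvint y hy)).symm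
    intro x hx y hy
    show (p y : ℂ) * (v y / p y) - p x * (v x / p x) = _
    rw [mul_div_cancel₀ _ (hpne y hy), mul_div_cancel₀ _ (hpne x hx),
      ← intervalIntegral.integral_interval_sub_left (hvint y hy) (hvint x hx),
      ← key y hy, ← key x hx]
    ring
  · have hB2 : Tendsto (fun x => B x * Q x ^ 2) atTop (nhds 0) := by
      refine squeeze_zero_norm (fun x => ?_) (tendsto_zero_iff_norm_tendsto_zero.1 hBl)
      simp [hQn]
    have := ((hmlim.inv₀ hm0).const_mul (2 * I)⁻¹).mul (hAl.sub hB2)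
    refine (this.congr fun x => ?_).trans (le_of_eq ?_)
    · have : Complex.exp (-(I * (Φ x : ℂ))) = Q x := by simp [hQ]
      simp only [hθ]
      rw [this]
      linear_combination (-(2 * I)⁻¹ * (m x)⁻¹ * A x) * hPQ x
    · congr 1; field_simp; simp
  · have hB2 : Tendsto (fun x => B x * Q x ^ 2) atTop (nhds 0) := by
      refine squeeze_zero_norm (fun x => ?_) (tendsto_zero_iff_norm_tendsto_zero.1 hBl)
      simp [hQn]
    have hpl : Tendsto (fun x => (p x : ℂ)) atTop (nhds (p₀ : ℂ)) :=
      (Complex.continuous_ofReal.tendsto _).comp hplim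
    have hp0 : (p₀ : ℂ) ≠ 0 := by exact_mod_cast hp₀.ne'
    have := ((hAl.add hB2).const_mul 2⁻¹).div hpl hp0
    refine (this.congr fun x => ?_).trans (le_of_eq ?_)
    · have : Complex.exp (-(I * (Φ x : ℂ))) = Q x := by simp [hQ]
      simp only [hv]
      rw [this, div_mul_eq_mul_div]
      show 2⁻¹ * (A x + B x * Q x ^ 2) / (p x : ℂ) = _
      congr 1
      linear_combination (-2⁻¹ * A x) * hPQ x
    · congr 1; field_simp; simp

lemma freeze {f f' : ℝ → ℝ} {c X : ℝ} (hc : 0 ≤ c) (hX : c ≤ X)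
    (hf : ∀ x, c ≤ x → f x = f c + ∫ t in c..x, f' t) (hi : IntegrableOn f' (Ioi c)) :
    ∃ g : ℝ → ℝ, Integrable g ∧ ∀ x, 0 ≤ x → f (max x X) = f X + ∫ t in (0:ℝ)..x, g t := by
  have hg : Integrable ((Ioi X).indicator f') :=
    (integrable_indicator_iff measurableSet_Ioi).2 (hi.mono_set (Ioi_subset_Ioi hX))
  refine ⟨(Ioi X).indicator f', hg, fun x hx => ?_⟩
  have hX0 : 0 ≤ X := hc.trans hX
  have hz : ∀ y, 0 ≤ y → y ≤ X → ∫ t in (0:ℝ)..y, (Ioi X).indicator f' t = 0 := by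
    intro y hy hyX
    rw [intervalIntegral.integral_congr (g := fun _ => (0:ℝ)), intervalIntegral.integral_zero]
    intro t ht
    rw [uIcc_of_le hy] at ht
    exact indicator_of_notMem (by simpa using ht.2.trans hyX) _
  rcases le_total x X with h | h
  · rw [max_eq_right h, hz x hx h, add_zero]
  · rw [max_eq_left h, ← intervalIntegral.integral_add_adjacent_intervals
      (b := X) hg.intervalIntegrable hg.intervalIntegrable, hz X hX0 le_rfl, zero_add]
    have h1 : ∫ t in X..x, (Ioi X).indicator f' t = ∫ t in X..x, f' t := by
      rw [intervalIntegral.integral_of_le h, intervalIntegral.integral_of_le h]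
      exact setIntegral_congr_fun measurableSet_Ioc fun t ht => indicator_of_mem (mem_Ioi.2 ht.1) _
    have hii : ∀ y, c ≤ y → IntervalIntegrable f' volume c y := fun y hy =>
      (intervalIntegrable_iff_integrableOn_Ioc_of_le hy).2 (hi.mono_set Ioc_subset_Ioi_self)
    rw [h1, hf x (hX.trans h), hf X hX, ← intervalIntegral.integral_interval_sub_left
      (hii x (hX.trans h)) (hii X hX)]
    ring

lemma cont_of_freeze {f f' : ℝ → ℝ} {c : ℝ} (hc : 0 ≤ c)
    (hf : ∀ x, c ≤ x → f x = f c + ∫ t in c..x, f' t) (hi : IntegrableOn f' (Ioi c)) :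
    ContinuousOn f (Ici c) := by
  obtain ⟨g, hg, h⟩ := freeze hc le_rfl hf hi
  have : Continuous fun x => f c + ∫ t in (0:ℝ)..x, g t :=
    continuous_const.add
      (intervalIntegral.continuous_primitive (fun a b => hg.intervalIntegrable) 0)
  refine this.continuousOn.congr fun x hx => ?_
  show f x = f c + ∫ t in (0:ℝ)..x, g t
  rw [← h x (hc.trans hx), max_eq_left hx]

/-- for `λ > 0` there is a solution `θ` of the Schrödinger equation with
spectral parameter `λ` on `[0,∞)` with `θ(x) e^{−iΦ(x,λ)} → K(λ)` and
`θ'(x) e^{−iΦ(x,λ)} → i√(λ/p₀) K(λ)` as `x → ∞`. -/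
theorem statement11 (p p' q q' : ℝ → ℝ) (p₀ x₀ : ℝ)
    (hPQ : PQData p p' q q' p₀ x₀)
    (lam : ℝ) (hlam : 0 < lam) :
    ∃ θ θ' : ℝ → ℂ,
      IsSol p q (lam : ℂ) (Ici 0) θ θ' ∧
      Tendsto (fun x => θ x * Complex.exp (-(Complex.I * (Phi p q lam x : ℂ))))
        atTop (nhds ((Kc p q lam : ℂ))) ∧
      Tendsto (fun x => θ' x * Complex.exp (-(Complex.I * (Phi p q lam x : ℂ))))
        atTop (nhds (Complex.I * (Real.sqrt (lam / p₀) : ℂ) * (Kc p q lam : ℂ))) := by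
  obtain ⟨hp, hp₀, hx₀, hpac, hp'i, hplim, hqi, hqac, hq'i, hqlim⟩ := hPQ
  have hpc : ContinuousOn p (Ici 0) := cont_of_freeze le_rfl hpac hp'i
  have hqc : ContinuousOn q (Ici x₀) := cont_of_freeze hx₀ hqac hq'i
  have hq : ∀ b, 0 ≤ b → IntervalIntegrable q volume 0 b := by
    intro b hb
    have h1 : IntervalIntegrable q volume 0 x₀ :=
      (intervalIntegrable_iff_integrableOn_Ioo_of_le hx₀).2 hqi
    have h2 : IntervalIntegrable q volume x₀ (max x₀ b) := by
      refine (hqc.mono ?_).intervalIntegrable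
      rw [uIcc_of_le (le_max_left _ _)]; exact Icc_subset_Ici_self
    refine (h1.trans h2).mono_set ?_
    rw [uIcc_of_le hb, uIcc_of_le (hb.trans (le_max_right _ _))]
    exact Icc_subset_Icc le_rfl (le_max_right _ _)
  set k : ℝ → ℝ := fun y => Real.sqrt (max ((lam - q y) / p y) 0) with hkdef
  have hk : ∀ b, 0 ≤ b → IntervalIntegrable k volume 0 b := by
    intro b hb
    have h1 : IntervalIntegrable (fun y => (lam - q y) * (p y)⁻¹) volume 0 b := by
      refine IntervalIntegrable.mul_continuousOn (intervalIntegrable_const.sub (hq b hb)) ?_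
      rw [uIcc_of_le hb]
      exact (hpc.mono Icc_subset_Ici_self).inv₀ fun x hx => (hp x hx.1).ne'
    have h2 : IntervalIntegrable (fun y => 1 + |(lam - q y) * (p y)⁻¹|) volume 0 b :=
      intervalIntegrable_const.add h1.abs
    refine h2.mono_fun' ?_ (Eventually.of_forall fun y => ?_)
    · have h3 := h1.aestronglyMeasurable_restrict_uIoc.aemeasurable
      exact ((h3.max aemeasurable_const).sqrt).aestronglyMeasurable
    · simp only [hkdef]
      rw [Real.norm_of_nonneg (Real.sqrt_nonneg _), div_eq_mul_inv]
      set z := (lam - q y) * (p y)⁻¹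
      have h3 : max z 0 ≤ |z| := max_le (le_abs_self z) (abs_nonneg z)
      have h4 : (0:ℝ) ≤ max z 0 := le_max_right _ _
      rw [Real.sqrt_le_left (by positivity)]
      nlinarith [abs_nonneg z]
  -- choice of the matching point
  obtain ⟨X, hX0, hXp, hXq⟩ : ∃ X, x₀ ≤ X ∧ (∀ x, X ≤ x → p₀ / 2 ≤ p x) ∧
      (∀ x, X ≤ x → lam / 2 ≤ lam - q x) := by
    have h1 : ∀ᶠ x in atTop, p₀ / 2 ≤ p x := hplim.eventually_const_le (by linarith)
    have h2 : ∀ᶠ x in atTop, q x ≤ lam / 2 := hqlim.eventually_le_const (by linarith)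
    obtain ⟨X1, h1⟩ := eventually_atTop.1 h1
    obtain ⟨X2, h2⟩ := eventually_atTop.1 h2
    refine ⟨max x₀ (max X1 X2), le_max_left _ _, fun x hx => h1 x ?_, fun x hx => ?_⟩
    · exact ((le_max_left _ _).trans (le_max_right _ _)).trans hx
    · have := h2 x (((le_max_right _ _).trans (le_max_right _ _)).trans hx)
      linarith
  have hX00 : 0 ≤ X := hx₀.trans hX0
  obtain ⟨gp, hgp, hgpe⟩ := freeze le_rfl hX00 hpac hp'i
  obtain ⟨gq, hgq, hgqe⟩ := freeze hx₀ hX0 hqac hq'i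
  set P : ℝ → ℝ := fun x => p (max x X) with hPdef
  set L : ℝ → ℝ := fun x => lam - q (max x X) with hLdef
  have hPc : Continuous P := hpc.comp_continuous (continuous_id.max continuous_const)
    fun x => mem_Ici.2 (hX00.trans (le_max_right _ _))
  have hLc : Continuous L := continuous_const.sub
    (hqc.comp_continuous (continuous_id.max continuous_const)
      fun x => mem_Ici.2 (hX0.trans (le_max_right _ _)))
  have hPb : ∀ x, p₀ / 2 ≤ P x := fun x => hXp _ (le_max_right _ _)
  have hLb : ∀ x, lam / 2 ≤ L x := fun x => hXq _ (le_max_right _ _)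
  have hPpos : ∀ x, 0 < P x := fun x => lt_of_lt_of_le (by linarith) (hPb x)
  have hLpos : ∀ x, 0 < L x := fun x => lt_of_lt_of_le (by linarith) (hLb x)
  set r : ℝ → ℝ := fun x => (gp x * (P x)⁻¹ - gq x * (L x)⁻¹) / 4 with hrdef
  have hdivi : ∀ g U : ℝ → ℝ, ∀ c, 0 < c → Integrable g → Continuous U → (∀ x, c ≤ U x) →
      Integrable fun x => g x * (U x)⁻¹ := by
    intro g U c hc hg hU hb
    have hpos : ∀ x, 0 < U x := fun x => hc.trans_le (hb x)
    refine hg.mul_bdd (c := c⁻¹) (hU.inv₀ fun x => (hpos x).ne').aestronglyMeasurable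
      (Eventually.of_forall fun x => ?_)
    rw [norm_inv, Real.norm_of_nonneg (hpos x).le]
    exact inv_anti₀ hc (hb x)
  have hri : Integrable r := ((hdivi gp P _ (by linarith) hgp hPc hPb).sub
    (hdivi gq L _ (half_pos hlam) hgq hLc hLb)).div_const 4
  set R : ℝ → ℝ := fun x => ∫ t in (0:ℝ)..x, 2 * r t with hRdef
  have hRd : ∀ b, 0 ≤ b → ACD (fun x => (R x : ℂ)) (fun x => 2 * (r x : ℂ)) 0 b := by
    intro b hb
    have h1 : IntervalIntegrable (fun x => 2 * (r x : ℂ)) volume 0 b :=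
      (hri.ofReal.const_mul 2).intervalIntegrable
    refine (ACD.of_integral hb h1 0).congr hb fun x _ => ?_
    simp only [hRdef]
    rw [zero_add, ← intervalIntegral.integral_ofReal]; simp
  have hRc : Continuous R := intervalIntegral.continuous_primitive
    (fun a b => (hri.const_mul 2).intervalIntegrable) 0
  set μ : ℝ := Real.sqrt (P 0 * L 0) with hμdef
  have hμpos : 0 < μ := Real.sqrt_pos.2 (mul_pos (hPpos 0) (hLpos 0))
  set m : ℝ → ℝ := fun x => μ * Real.exp (R x) with hmdef
  have hmpos : ∀ x, 0 < m x := fun x => mul_pos hμpos (Real.exp_pos _)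
  have hmc : Continuous m := by fun_prop
  have hP0 : P 0 = p X := by simp only [hPdef]; rw [max_eq_right hX00]
  have hL0 : L 0 = lam - q X := by simp only [hLdef]; rw [max_eq_right hX00]
  have hmsq : ∀ x, 0 ≤ x → m x ^ 2 = P x * L x := by
    intro b hb
    have h1 : ACD (fun x => (P x : ℂ)) (fun x => (gp x : ℂ)) 0 b := by
      refine (ACD.of_integral hb (hgp.ofReal.intervalIntegrable) (p X : ℂ)).congr hb fun x hx => ?_
      simp only [hPdef]
      rw [hgpe x hx.1, intervalIntegral.integral_ofReal]; push_cast; rfl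
    have h2 : ACD (fun x => (L x : ℂ)) (fun x => -(gq x : ℂ)) 0 b := by
      have := (ACD.const (lam : ℂ) 0 b).sub
        (ACD.of_integral (g := fun t => (gq t : ℂ)) hb (hgq.ofReal.intervalIntegrable) (q X : ℂ))
      refine (this.congr hb fun x hx => ?_).congr_deriv fun x _ => by simp
      simp only [hLdef]
      rw [hgqe x hx.1, intervalIntegral.integral_ofReal]; push_cast; rfl
    have h3 := (((hRd b hb).const_mul (-2)).exp.mul (h1.mul h2)).congr_deriv (g2 := fun _ => 0)
      fun x _ => by
        have h4 : (P x : ℂ) ≠ 0 := by exact_mod_cast (hPpos x).ne'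
        have h5 : (L x : ℂ) ≠ 0 := by exact_mod_cast (hLpos x).ne'
        simp only [hrdef]
        push_cast
        field_simp
        ring
    have h6 := h3.ftc hb intervalIntegrable_const
    have hR0 : R 0 = 0 := by simp [hRdef]
    simp only [intervalIntegral.integral_zero, hR0] at h6
    have h7 : Real.exp (-2 * R b) * (P b * L b) = P 0 * L 0 := by
      have : Complex.exp (-2 * (R b : ℂ)) * ((P b : ℂ) * L b) = (P 0 : ℂ) * L 0 := by
        simp at h6 ⊢
        linear_combination -h6
      exact_mod_cast this
    simp only [hmdef]
    rw [mul_pow, hμdef, Real.sq_sqrt (mul_pos (hPpos 0) (hLpos 0)).le, ← h7, ← Real.exp_nat_mul]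
    have h8 : Real.exp (-2 * R b) * Real.exp ((2:ℕ) * R b) = 1 := by
      rw [← Real.exp_add, Real.exp_eq_one_iff]; push_cast; ring
    linear_combination (P b * L b) * h8
  have hmX : ∀ x, X ≤ x → m x ^ 2 = p x * (lam - q x) := fun x hx => by
    rw [hmsq x (hX00.trans hx)]
    simp only [hPdef, hLdef]; rw [max_eq_left hx]
  have hkX : ∀ x, X ≤ x → k x ^ 2 * p x = lam - q x := fun x hx => by
    have h1 : 0 < p x := hp x (hX00.trans hx)
    have h2 : 0 < lam - q x := lt_of_lt_of_le (half_pos hlam) (hXq x hx)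
    simp only [hkdef]
    rw [max_eq_left (div_pos h2 h1).le, Real.sq_sqrt (div_pos h2 h1).le]
    field_simp
  have hk0 : ∀ x, 0 ≤ k x := fun x => Real.sqrt_nonneg _
  have hmk : ∀ x, X ≤ x → m x = p x * k x := fun x hx => by
    have h1 : 0 < p x := hp x (hX00.trans hx)
    have h2 : m x ^ 2 = (p x * k x) ^ 2 := by
      rw [hmX x hx, ← hkX x hx]; ring
    exact (pow_left_inj₀ (hmpos x).le (mul_nonneg h1.le (hk0 x)) two_ne_zero).1 h2
  set m0 : ℝ := Real.sqrt (lam * p₀) with hm0def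
  have hm0pos : 0 < m0 := Real.sqrt_pos.2 (mul_pos hlam hp₀)
  have hmlim : Tendsto m atTop (nhds m0) := by
    have h1 : Tendsto (fun x => Real.sqrt (p x * (lam - q x))) atTop
        (nhds (Real.sqrt (p₀ * (lam - 0)))) := (hplim.mul (tendsto_const_nhds.sub hqlim)).sqrt
    rw [sub_zero, mul_comm] at h1
    refine h1.congr' ?_
    filter_upwards [eventually_ge_atTop X] with x hx
    rw [← hmX x hx, Real.sqrt_sq (hmpos x).le]
  have hsplit : ∀ s : ℝ → ℂ, IntervalIntegrable s volume 0 X → (∀ x, X < x → s x = 0) →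
      IntegrableOn s (Ioi 0) := by
    intro s h1 h2
    rw [← Ioc_union_Ioi_eq_Ioi hX00]
    refine ((intervalIntegrable_iff_integrableOn_Ioc_of_le hX00).1 h1).union ?_
    exact (integrableOn_zero (s := Ioi X)).congr_fun (fun x hx => (h2 x hx).symm) measurableSet_Ioi
  have hmcc : Continuous fun x => (m x : ℂ) := Complex.continuous_ofReal.comp hmc
  have hmne : ∀ x, (m x : ℂ) ≠ 0 := fun x => by exact_mod_cast (hmpos x).ne'
  obtain ⟨θ, θ', h1, h2, h3⟩ := core (R := fun x => (R x : ℂ)) (r := fun x => (r x : ℂ))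
    (m := fun x => (m x : ℂ)) (μ := μ) (m0 := m0) (k := k) (lam := lam)
    (s1 := fun x => ((q x : ℂ) - lam + m x * k x) / (2 * I * m x))
    (s2 := fun x => I * (m x / p x - k x) / 2)
    hpc hp hp₀ hplim hq hk hRd hri.ofReal.integrableOn (by exact_mod_cast hμpos.ne')
    (fun x => by simp [hmdef]) (fun x => rfl) (fun x => rfl)
    (by
      refine hsplit _ ?_ fun x hx => ?_
      · have h1 : IntervalIntegrable (fun x => (q x : ℂ) - lam + m x * k x) volume 0 X :=
          ((ofRealII (hq X hX00)).sub intervalIntegrable_const).add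
            ((ofRealII (hk X hX00)).continuousOn_mul hmcc.continuousOn)
        have h2 : Continuous fun x => (2 * I * (m x : ℂ))⁻¹ :=
          (continuous_const.mul hmcc).inv₀ fun x =>
            mul_ne_zero (mul_ne_zero two_ne_zero I_ne_zero) (hmne x)
        exact h1.mul_continuousOn h2.continuousOn
      · have h3 : q x - lam + m x * k x = 0 := by
          rw [hmk x hx.le]; linarith [hkX x hx.le]
        have h4 : (q x : ℂ) - lam + m x * k x = 0 := by exact_mod_cast h3
        simp only [h4, zero_div])
    (by
      refine hsplit _ ?_ fun x hx => ?_
      · have hpcc : ContinuousOn (fun x => (p x : ℂ)) (uIcc 0 X) := by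
          rw [uIcc_of_le hX00]
          exact Complex.continuous_ofReal.comp_continuousOn (hpc.mono Icc_subset_Ici_self)
        have h1 : ContinuousOn (fun x => (m x : ℂ) / p x) (uIcc 0 X) := by
          refine hmcc.continuousOn.div hpcc fun x hx => ?_
          rw [uIcc_of_le hX00] at hx
          exact_mod_cast (hp x hx.1).ne'
        exact ((h1.intervalIntegrable.sub (ofRealII (hk X hX00))).const_mul I).div_const 2
      · have h1 : (p x : ℂ) ≠ 0 := by exact_mod_cast (hp x (hX00.trans hx.le)).ne'
        have h4 : (m x : ℂ) = p x * k x := by exact_mod_cast hmk x hx.le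
        simp only [h4]
        field_simp; simp)
    (by exact_mod_cast hm0pos.ne') ((Complex.continuous_ofReal.tendsto _).comp hmlim)
    (2 * I * m0 * (Kc p q lam : ℂ))
  have hm0ne : (m0 : ℂ) ≠ 0 := by exact_mod_cast hm0pos.ne'
  have hp0ne : (p₀ : ℂ) ≠ 0 := by exact_mod_cast hp₀.ne'
  refine ⟨θ, θ', h1, ?_, ?_⟩
  · have h4 : 2 * I * m0 * (Kc p q lam : ℂ) / (2 * I * m0) = Kc p q lam := by
      field_simp
    rw [h4] at h2
    exact h2
  · have h5 : Real.sqrt (lam / p₀) * p₀ = m0 := by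
      have : lam * p₀ = lam / p₀ * p₀ ^ 2 := by field_simp
      rw [hm0def, this, Real.sqrt_mul (div_pos hlam hp₀).le, Real.sqrt_sq hp₀.le]
    have h4 : 2 * I * m0 * (Kc p q lam : ℂ) / (2 * p₀)
        = I * (Real.sqrt (lam / p₀) : ℂ) * (Kc p q lam : ℂ) := by
      rw [← h5]; push_cast; field_simp
    rw [h4] at h3
    exact h3

end
end

section
/- Let λ > 0. If f solves the Schrödinger equation with spectral parameter λ on [0,∞), f(0) = 0, and f is square integrable on (0,∞), then f(x) = 0 for all x ≥ 0. (In other words, the operator H = −(d/dx)p(x)(d/dx) + q(x) with the boundary condition f(0) = 0 has no positive eigenvalues.) -/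
open MeasureTheory Filter Set Complex

noncomputable section

/-- `F` is a primitive of the locally integrable `g` on `[a,∞)`. -/
def Prim14 (F g : ℝ → ℝ) (a : ℝ) : Prop :=
  ∀ y, a ≤ y → IntervalIntegrable g volume a y ∧ F y = F a + ∫ t in a..y, g t

theorem Prim14.ii {F g : ℝ → ℝ} {a x y : ℝ} (h : Prim14 F g a) (hx : a ≤ x) (hy : a ≤ y) :
    IntervalIntegrable g volume x y := (h x hx).1.symm.trans (h y hy).1

theorem Prim14.sub_eq {F g : ℝ → ℝ} {a x y : ℝ} (h : Prim14 F g a) (hx : a ≤ x) (hy : a ≤ y) :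
    F y - F x = ∫ t in x..y, g t := by
  rw [(h x hx).2, (h y hy).2,
    ← intervalIntegral.integral_interval_sub_left (h y hy).1 (h x hx).1]
  ring

theorem Prim14.mono {F g : ℝ → ℝ} {a b : ℝ} (h : Prim14 F g a) (hb : a ≤ b) : Prim14 F g b :=
  fun y hy => ⟨h.ii hb (hb.trans hy), by rw [← h.sub_eq hb (hb.trans hy)]; ring⟩

theorem contOn_Ici14 {F : ℝ → ℝ} {a : ℝ} (h : ∀ b, a ≤ b → ContinuousOn F (Icc a b)) :
    ContinuousOn F (Ici a) := by
  intro x hx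
  have hx' : a ≤ x := hx
  have h1 := h (x+1) (by linarith) x ⟨hx', by linarith⟩
  refine h1.mono_of_mem_nhdsWithin ?_
  have : Iio (x+1) ∈ nhds x := Iio_mem_nhds (by linarith)
  filter_upwards [self_mem_nhdsWithin, mem_nhdsWithin_of_mem_nhds this] with y hy hy2
  exact ⟨hy, le_of_lt hy2⟩

theorem Prim14.cont {F g : ℝ → ℝ} {a : ℝ} (h : Prim14 F g a) : ContinuousOn F (Ici a) := by
  apply contOn_Ici14
  intro b hb
  have h1 := intervalIntegral.continuousOn_primitive_interval' (h b hb).1 (left_mem_uIcc)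
  rw [uIcc_of_le hb] at h1
  exact (continuousOn_const.add h1).congr fun y hy => (h y hy.1).2

theorem Prim14.congr {F g g' : ℝ → ℝ} {a : ℝ} (h : Prim14 F g a) (he : ∀ x, a ≤ x → g x = g' x) :
    Prim14 F g' a := by
  intro y hy
  have h2 : ∀ x ∈ uIoc a y, g x = g' x := by
    intro x hx; rw [uIoc_of_le hy] at hx; exact he x hx.1.le
  refine ⟨(h y hy).1.congr h2, ?_⟩
  rw [(h y hy).2, intervalIntegral.integral_congr_ae (Eventually.of_forall h2)]

theorem Prim14.add {F g G k : ℝ → ℝ} {a : ℝ} (h : Prim14 F g a) (h' : Prim14 G k a) :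
    Prim14 (fun x => F x + G x) (fun x => g x + k x) a := by
  intro y hy
  refine ⟨(h y hy).1.add (h' y hy).1, ?_⟩
  simp only
  rw [intervalIntegral.integral_add (h y hy).1 (h' y hy).1, (h y hy).2, (h' y hy).2]
  ring

theorem Prim14.csub {F g : ℝ → ℝ} {a : ℝ} (c : ℝ) (h : Prim14 F g a) :
    Prim14 (fun x => c - F x) (fun x => - g x) a := by
  intro y hy
  refine ⟨(h y hy).1.neg, ?_⟩
  simp only
  rw [intervalIntegral.integral_neg, (h y hy).2]
  ring

theorem Prim14.mul {F g G k : ℝ → ℝ} {a : ℝ} (h : Prim14 F g a) (h' : Prim14 G k a) :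
    Prim14 (fun x => F x * G x) (fun x => g x * G x + F x * k x) a := by
  intro y hy
  have sub : uIcc a y ⊆ Ici a := by rw [uIcc_of_le hy]; exact Icc_subset_Ici_self
  refine ⟨((h y hy).1.mul_continuousOn (h'.cont.mono sub)).add
    ((h' y hy).1.continuousOn_mul (h.cont.mono sub)), ?_⟩
  have acc : ∀ {F g : ℝ → ℝ}, Prim14 F g a →
      AbsolutelyContinuousOnInterval (fun x => F a + ∫ t in a..x, g t) a y := by
    intro F g h
    have h1 := (h y hy).1.absolutelyContinuousOnInterval_intervalIntegral
      (c := a) left_mem_uIcc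
    have h2 : AbsolutelyContinuousOnInterval (fun _ : ℝ => F a) a y :=
      (LipschitzWith.const (F a)).lipschitzOnWith.absolutelyContinuousOnInterval
    exact h2.add h1
  have key := (acc h).integral_deriv_mul_eq_sub (acc h')
  have e : ∫ x in a..y, (g x * G x + F x * k x) =
      ∫ x in a..y, (deriv (fun x => F a + ∫ t in a..x, g t) x * (G a + ∫ t in a..x, k t)
        + (F a + ∫ t in a..x, g t) * deriv (fun x => G a + ∫ t in a..x, k t) x) := by
    apply intervalIntegral.integral_congr_ae
    filter_upwards [(h y hy).1.ae_hasDerivAt_integral, (h' y hy).1.ae_hasDerivAt_integral]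
      with x h1 h2 hx
    have hx' := uIoc_subset_uIcc hx
    rw [((h1 hx' a left_mem_uIcc).const_add (F a)).deriv,
      ((h2 hx' a left_mem_uIcc).const_add (G a)).deriv, ← (h x (sub hx')).2,
      ← (h' x (sub hx')).2]
  simp only
  rw [e, key, (h y hy).2, (h' y hy).2]
  simp

theorem uniq14 {f u A k : ℝ → ℝ} (hf : Prim14 f (fun x => A x * u x) 0)
    (hu : Prim14 u (fun x => k x * f x) 0)
    (hA : ∀ y, 0 ≤ y → IntervalIntegrable A volume 0 y)
    (hk : ∀ y, 0 ≤ y → IntervalIntegrable k volume 0 y)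
    {a : ℝ} (ha : 0 ≤ a) (hfa : f a = 0) (hua : u a = 0) : ∀ x, 0 ≤ x → f x = 0 := by
  set φ : ℝ → ℝ := fun x => |f x| + |u x| with hφ
  have cφ : ContinuousOn φ (Ici 0) := hf.cont.abs.add hu.cont.abs
  set g : ℝ → ℝ := fun x => |A x| + |k x| with hg
  have hK : Prim14 (fun x => ∫ t in (0:ℝ)..x, g t) g 0 := by
    intro y hy
    exact ⟨(hA y hy).abs.add (hk y hy).abs, by simp⟩
  have step : ∀ s, 0 ≤ s → φ s = 0 → ∀ᶠ x in nhdsWithin s (Ici 0), φ x = 0 := by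
    intro s hs h0
    have hf0 : f s = 0 := by
      have := abs_nonneg (f s); have := abs_nonneg (u s)
      exact abs_eq_zero.1 (by simp only [hφ] at h0; linarith)
    have hu0 : u s = 0 := by
      have := abs_nonneg (f s); have := abs_nonneg (u s)
      exact abs_eq_zero.1 (by simp only [hφ] at h0; linarith)
    have hc := Metric.continuousWithinAt_iff.1 (hK.cont s hs) (1/2) (by norm_num)
    obtain ⟨δ, hδ, hc⟩ := hc
    filter_upwards [self_mem_nhdsWithin, mem_nhdsWithin_of_mem_nhds (Metric.ball_mem_nhds s hδ)]
      with x hx hxd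
    have hx : 0 ≤ x := hx
    have sub : uIcc s x ⊆ Ici 0 := by
      intro t ht; exact (le_min hs hx).trans ht.1
    obtain ⟨y, hy, hmax⟩ := isCompact_uIcc.exists_isMaxOn (nonempty_uIcc) (cφ.mono sub)
    have hy0 : 0 ≤ y := sub hy
    have hφ0 : ∀ t, 0 ≤ φ t := fun t => by positivity
    have suby : uIoc s y ⊆ uIcc s x :=
      uIoc_subset_uIcc.trans (uIcc_subset_uIcc left_mem_uIcc hy)
    have b : ∀ {F B v : ℝ → ℝ}, Prim14 F (fun x => B x * v x) 0 → F s = 0 →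
        (∀ y, 0 ≤ y → IntervalIntegrable B volume 0 y) → (∀ t, |v t| ≤ φ t) →
        |F y| ≤ φ y * abs (∫ t in s..y, abs (B t)) := by
      intro F B v h1 h2 h3 h4
      have : F y = ∫ t in s..y, B t * v t := by rw [← h1.sub_eq hs hy0, h2]; ring
      have iB : IntervalIntegrable B volume s y := (h3 s hs).symm.trans (h3 y hy0)
      have h5 := intervalIntegral.norm_integral_le_abs_of_norm_le (f := fun t => B t * v t)
        (g := fun t => φ y * |B t|) (a := s) (b := y) (μ := volume) ?_ (iB.abs.const_mul _)
      · rw [this]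
        rw [intervalIntegral.integral_const_mul, abs_mul, abs_of_nonneg (hφ0 y)] at h5
        exact h5
      · refine (ae_restrict_iff' measurableSet_uIoc).2 (Eventually.of_forall fun t ht => ?_)
        have := hmax (suby ht)
        simp only [mem_setOf_eq] at this
        rw [Real.norm_eq_abs, abs_mul, mul_comm]
        exact mul_le_mul_of_nonneg_right ((h4 t).trans this) (abs_nonneg _)
    have b1 := b hf hf0 hA (fun t => by simp only [hφ]; linarith [abs_nonneg (f t)])
    have b2 := b hu hu0 hk (fun t => by simp only [hφ]; linarith [abs_nonneg (u t)])
    have iA : IntervalIntegrable A volume s y := (hA s hs).symm.trans (hA y hy0)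
    have ik : IntervalIntegrable k volume s y := (hk s hs).symm.trans (hk y hy0)
    have sum : abs (∫ t in s..y, abs (A t)) + abs (∫ t in s..y, abs (k t)) = |∫ t in s..y, g t| := by
      rw [hg, intervalIntegral.integral_add iA.abs ik.abs]
      rcases le_total s y with h | h
      · have h1 := intervalIntegral.integral_nonneg (μ := volume) h (fun t _ => abs_nonneg (A t))
        have h2 := intervalIntegral.integral_nonneg (μ := volume) h (fun t _ => abs_nonneg (k t))
        rw [abs_of_nonneg h1, abs_of_nonneg h2, abs_of_nonneg (by positivity)]
      · have h1 := intervalIntegral.integral_nonneg (μ := volume) h (fun t _ => abs_nonneg (A t))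
        have h2 := intervalIntegral.integral_nonneg (μ := volume) h (fun t _ => abs_nonneg (k t))
        rw [intervalIntegral.integral_symm] at h1 h2
        rw [abs_of_nonpos (by linarith), abs_of_nonpos (by linarith), abs_of_nonpos (by linarith)]
        ring
    have hyd : dist y s < δ := by
      have h1 : dist x s < δ := hxd
      rw [Real.dist_eq] at h1 ⊢
      exact lt_of_le_of_lt (abs_sub_left_of_mem_uIcc hy) h1
    have hd := hc (show y ∈ Ici 0 from hy0) hyd
    rw [Real.dist_eq, hK.sub_eq hs hy0] at hd
    have fin : φ y ≤ φ y * |∫ t in s..y, g t| := by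
      rw [← sum, mul_add]; exact add_le_add b1 b2
    have z : φ y = 0 := by nlinarith [hφ0 y]
    have := hmax (right_mem_uIcc : x ∈ uIcc s x)
    simp only [mem_setOf_eq] at this
    exact le_antisymm (by linarith) (hφ0 x)
  have all : ∀ x, 0 ≤ x → φ x = 0 := by
    have cl : IsClopen {x : Ici (0:ℝ) | φ x = 0} := by
      constructor
      · exact isClosed_eq (continuousOn_iff_continuous_restrict.1 cφ) continuous_const
      · rw [isOpen_iff_mem_nhds]
        rintro ⟨s, hs⟩ h0
        have := step s hs h0
        rw [nhds_subtype_eq_comap_nhdsWithin]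
        exact ⟨_, this, fun x hx => hx⟩
    have : PreconnectedSpace (Ici (0:ℝ)) := Subtype.preconnectedSpace isPreconnected_Ici
    have hu := cl.eq_univ ⟨⟨a, ha⟩, by simp [hφ, hfa, hua]⟩
    intro x hx
    have : (⟨x, hx⟩ : Ici (0:ℝ)) ∈ {x : Ici (0:ℝ) | φ x = 0} := by rw [hu]; trivial
    exact this
  intro x hx
  have h := all x hx
  have := abs_nonneg (f x); have := abs_nonneg (u x)
  exact abs_eq_zero.1 (by simp only [hφ] at h; linarith)

theorem tail14 {h : ℝ → ℝ} {x₀ : ℝ} (hi : IntegrableOn h (Ioi x₀)) {η : ℝ} (hη : 0 < η) :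
    ∀ᶠ a in atTop, ∀ y, a ≤ y → ∫ t in a..y, h t ≤ η := by
  have h1 := intervalIntegral_tendsto_integral_Ioi x₀ hi tendsto_id
  have h2 := (Metric.tendsto_nhds.1 h1 (η/2) (by linarith))
  obtain ⟨N, hN⟩ := eventually_atTop.1 h2
  have ii : ∀ y, x₀ ≤ y → IntervalIntegrable h volume x₀ y := fun y hy =>
    (intervalIntegrable_iff_integrableOn_Ioc_of_le hy).2 (hi.mono_set Ioc_subset_Ioi_self)
  filter_upwards [eventually_ge_atTop N, eventually_ge_atTop x₀] with a ha ha' y hy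
  have e1 := hN a ha
  have e2 := hN y (ha.trans hy)
  rw [Real.dist_eq, abs_lt] at e1 e2
  rw [← intervalIntegral.integral_interval_sub_left (ii y (ha'.trans hy)) (ii a ha')]
  simp only [id] at e1 e2
  linarith [e1.1, e2.2]

theorem qi14 {p p' q q' : ℝ → ℝ} {p₀ x₀ : ℝ} (hPQ : PQData p p' q q' p₀ x₀) :
    ∀ y, 0 ≤ y → IntervalIntegrable q volume 0 y := by
  intro y hy
  have hq : Prim14 q q' x₀ := fun y hy =>
    ⟨(intervalIntegrable_iff_integrableOn_Ioc_of_le hy).2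
      (hPQ.q'_int.mono_set Ioc_subset_Ioi_self), hPQ.q_ac y hy⟩
  have h1 : IntervalIntegrable q volume 0 x₀ :=
    (intervalIntegrable_iff_integrableOn_Ioo_of_le hPQ.hx₀).2 hPQ.q_int
  have h2 : IntervalIntegrable q volume x₀ (max x₀ y) := by
    apply ContinuousOn.intervalIntegrable
    apply hq.cont.mono
    rw [uIcc_of_le (le_max_left _ _)]
    exact Icc_subset_Ici_self
  refine (h1.trans h2).mono_set ?_
  rw [uIcc_of_le hy, uIcc_of_le (hPQ.hx₀.trans (le_max_left _ _))]
  exact Icc_subset_Icc_right (le_max_right _ _)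

theorem ii14 {p p' q q' : ℝ → ℝ} {p₀ x₀ : ℝ} (hPQ : PQData p p' q q' p₀ x₀) (lam : ℝ)
    {f : ℝ → ℂ} (hfc : ContinuousOn f (Ici 0)) {x y : ℝ} (hx : 0 ≤ x) (hy : 0 ≤ y) :
    IntervalIntegrable (fun t => ((q t : ℂ) - (lam : ℂ)) * f t) volume x y := by
  have h1 : IntervalIntegrable q volume x y := (qi14 hPQ x hx).symm.trans (qi14 hPQ y hy)
  have h2 : IntervalIntegrable (fun t => (q t : ℂ)) volume x y := ⟨h1.1.ofReal, h1.2.ofReal⟩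
  exact (h2.sub intervalIntegrable_const).mul_continuousOn
    (hfc.mono fun t ht => (le_min hx hy).trans ht.1)

theorem real14 (p p' q q' : ℝ → ℝ) (p₀ x₀ : ℝ)
    (hPQ : PQData p p' q q' p₀ x₀)
    (lam : ℝ) (hlam : 0 < lam)
    (f f' : ℝ → ℝ)
    (hd : ∀ x ∈ Ici (0:ℝ), HasDerivWithinAt f (f' x) (Ici 0) x)
    (hI : ∀ x ∈ Ici (0:ℝ), ∀ y ∈ Ici (0:ℝ),
      p y * f' y - p x * f' x = ∫ t in x..y, (q t - lam) * f t)
    (hL2 : IntegrableOn (fun x => f x ^ 2) (Ioi (0:ℝ))) :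
    ∀ x : ℝ, 0 ≤ x → f x = 0 := by
  have hqi := qi14 hPQ
  obtain ⟨p_pos, hp₀, hx₀, p_ac, p'_int, p_lim, q_int, q_ac, q'_int, q_lim⟩ := hPQ
  have hp : Prim14 p p' 0 := fun y hy =>
    ⟨(intervalIntegrable_iff_integrableOn_Ioc_of_le hy).2 (p'_int.mono_set Ioc_subset_Ioi_self),
      p_ac y hy⟩
  have hq : Prim14 q q' x₀ := fun y hy =>
    ⟨(intervalIntegrable_iff_integrableOn_Ioc_of_le hy).2 (q'_int.mono_set Ioc_subset_Ioi_self),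
      q_ac y hy⟩
  have hki : ∀ y, 0 ≤ y → IntervalIntegrable (fun x => q x - lam) volume 0 y :=
    fun y hy => (hqi y hy).sub intervalIntegrable_const
  have hfc : ContinuousOn f (Ici 0) := fun x hx => (hd x hx).continuousWithinAt
  have sub : ∀ y : ℝ, 0 ≤ y → uIcc 0 y ⊆ Ici 0 := fun y hy => by
    rw [uIcc_of_le hy]; exact Icc_subset_Ici_self
  obtain ⟨u, hudef⟩ : ∃ u : ℝ → ℝ, u = fun x => p x * f' x := ⟨_, rfl⟩
  have hu : Prim14 u (fun x => (q x - lam) * f x) 0 := by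
    intro y hy
    refine ⟨(hki y hy).mul_continuousOn (hfc.mono (sub y hy)), ?_⟩
    rw [← hI 0 self_mem_Ici y hy, hudef]; ring
  have hpinv : ContinuousOn (fun x => (p x)⁻¹) (Ici 0) :=
    hp.cont.inv₀ fun x hx => (p_pos x hx).ne'
  have hf : Prim14 f (fun x => (p x)⁻¹ * u x) 0 := by
    intro y hy
    have hc : IntervalIntegrable (fun x => (p x)⁻¹ * u x) volume 0 y :=
      ((hpinv.mul hu.cont).mono (sub y hy)).intervalIntegrable
    refine ⟨hc, ?_⟩
    have := intervalIntegral.integral_eq_sub_of_hasDeriv_right_of_le hy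
      (hfc.mono Icc_subset_Ici_self) (f' := fun x => (p x)⁻¹ * u x) (fun x hx => ?_) hc
    · rw [this]; ring
    · have h1 := hd x hx.1.le
      have : (p x)⁻¹ * u x = f' x := by
        have := (p_pos x hx.1.le).ne'
        rw [hudef]; field_simp
      rw [this]
      exact h1.mono (fun t ht => (hx.1.trans ht).le)
  by_contra hne
  have hnz : ∀ a, 0 ≤ a → ¬ (f a = 0 ∧ u a = 0) := fun a ha h =>
    hne (uniq14 hf hu (fun y hy => (hpinv.mono (sub y hy)).intervalIntegrable) hki ha h.1 h.2)
  -- choice of the base point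
  set m := p₀ * lam / 4 with hm
  have hm0 : 0 < m := by positivity
  have hint : IntegrableOn (fun t => 2 * lam * |p' t| + 2 * p₀ * |q' t|) (Ioi x₀) :=
    ((p'_int.mono_set (Ioi_subset_Ioi hx₀)).abs.const_mul _).add (q'_int.abs.const_mul _)
  have ev1 : ∀ᶠ x in atTop, p₀ / 2 < p x := p_lim.eventually_const_lt (by linarith)
  have ev2 : ∀ᶠ x in atTop, p x < 2 * p₀ := p_lim.eventually_lt_const (by linarith)
  have ev3 : ∀ᶠ x in atTop, q x < lam / 2 := q_lim.eventually_lt_const (by linarith)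
  have ev4 : ∀ᶠ x in atTop, - lam < q x := q_lim.eventually_const_lt (by linarith)
  obtain ⟨N, hN⟩ := eventually_atTop.1 (ev1.and (ev2.and (ev3.and ev4)))
  obtain ⟨a, haN, hax, hat⟩ := ((eventually_ge_atTop N).and ((eventually_ge_atTop x₀).and
    (tail14 hint (η := m / 4) (by linarith)))).exists
  have ha0 : 0 ≤ a := hx₀.trans hax
  have b1 : ∀ x, a ≤ x → p₀ / 2 < p x := fun x hx => (hN x (haN.trans hx)).1
  have b2 : ∀ x, a ≤ x → p x < 2 * p₀ := fun x hx => (hN x (haN.trans hx)).2.1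
  have b3 : ∀ x, a ≤ x → lam / 2 < lam - q x := fun x hx => by
    linarith [(hN x (haN.trans hx)).2.2.1]
  have b4 : ∀ x, a ≤ x → lam - q x < 2 * lam := fun x hx => by
    linarith [(hN x (haN.trans hx)).2.2.2]
  have bw : ∀ x, a ≤ x → m ≤ p x * (lam - q x) := fun x hx => by
    have := mul_le_mul (b1 x hx).le (b3 x hx).le (by positivity)
      (by linarith [b1 x hx] : 0 ≤ p x)
    rw [hm]; linarith
  -- the energy
  have hpa := hp.mono ha0
  have hqa := hq.mono hax
  have hfa := hf.mono ha0
  have hua := hu.mono ha0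
  obtain ⟨E, hE⟩ : ∃ E : ℝ → ℝ, E = fun x => u x * u x + (p x * (lam - q x)) * (f x * f x) :=
    ⟨_, rfl⟩
  have hEp : Prim14 E (fun x => (p' x * (lam - q x) - p x * q' x) * (f x * f x)) a := by
    rw [hE]
    refine ((hua.mul hua).add ((hpa.mul (hqa.csub lam)).mul (hfa.mul hfa))).congr ?_
    intro x hx
    have := (p_pos x (ha0.trans hx)).ne'
    field_simp
    ring
  have hEf : ∀ x, a ≤ x → m * (f x * f x) ≤ E x := fun x hx => by
    have := mul_le_mul_of_nonneg_right (bw x hx) (mul_self_nonneg (f x))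
    rw [hE]; simp only; nlinarith [mul_self_nonneg (u x)]
  have hEu : ∀ x, a ≤ x → u x * u x ≤ E x := fun x hx => by
    have := mul_le_mul_of_nonneg_right (bw x hx) (mul_self_nonneg (f x))
    have := mul_nonneg hm0.le (mul_self_nonneg (f x))
    rw [hE]; simp only; linarith
  have hE0 : ∀ x, a ≤ x → 0 ≤ E x := fun x hx => (mul_self_nonneg _).trans (hEu x hx)
  have hEa : 0 < E a := by
    rcases (hE0 a le_rfl).eq_or_lt with h | h
    · exfalso
      apply hnz a ha0
      have h1 := hEf a le_rfl
      have h2 := hEu a le_rfl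
      rw [← h] at h1 h2
      constructor
      · exact mul_self_eq_zero.1 (le_antisymm (by nlinarith) (mul_self_nonneg _))
      · exact mul_self_eq_zero.1 (le_antisymm h2 (mul_self_nonneg _))
    · exact h
  have osc : ∀ X, a ≤ X → ∀ M, (∀ t ∈ Icc a X, E t ≤ M) → |E X - E a| ≤ M / 4 := by
    intro X hX M hM
    rw [hEp.sub_eq le_rfl hX]
    have hM0 : 0 ≤ M := (hE0 a le_rfl).trans (hM a ⟨le_rfl, hX⟩)
    have hii : IntervalIntegrable (fun t => 2 * lam * |p' t| + 2 * p₀ * |q' t|) volume a X :=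
      (intervalIntegrable_iff_integrableOn_Ioc_of_le hX).2
        (hint.mono_set (Ioc_subset_Ioi_self.trans (Ioi_subset_Ioi hax)))
    have h5 := intervalIntegral.norm_integral_le_of_norm_le (μ := volume) hX
      (f := fun x => (p' x * (lam - q x) - p x * q' x) * (f x * f x))
      (g := fun t => (M / m) * (2 * lam * |p' t| + 2 * p₀ * |q' t|))
      (Eventually.of_forall fun t ht => ?_) (hii.const_mul _)
    · rw [intervalIntegral.integral_const_mul] at h5
      refine h5.trans ((mul_le_mul_of_nonneg_left (hat X hX) (by positivity)).trans ?_)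
      apply le_of_eq; field_simp
    · have hta : a ≤ t := ht.1.le
      have hff : f t * f t ≤ M / m := by
        rw [le_div_iff₀ hm0]
        linarith [hEf t hta, hM t ⟨hta, ht.2⟩]
      rw [Real.norm_eq_abs, abs_mul, abs_of_nonneg (mul_self_nonneg (f t)), mul_comm]
      refine mul_le_mul hff ?_ (abs_nonneg _) (by positivity)
      refine (abs_sub _ _).trans ?_
      rw [abs_mul, abs_mul, abs_of_pos (p_pos t (ha0.trans hta)),
        abs_of_pos (by linarith [b3 t hta] : 0 < lam - q t)]
      have h1 := mul_le_mul_of_nonneg_left (b4 t hta).le (abs_nonneg (p' t))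
      have h2 := mul_le_mul_of_nonneg_right (b2 t hta).le (abs_nonneg (q' t))
      linarith
  have upper : ∀ X, a ≤ X → E X ≤ 4 / 3 * E a := by
    intro X hX
    obtain ⟨y, hy, hmax⟩ := isCompact_Icc.exists_isMaxOn (nonempty_Icc.2 hX)
      (hEp.cont.mono Icc_subset_Ici_self)
    have h1 := osc y hy.1 (E y) (fun t ht => hmax ⟨ht.1, ht.2.trans hy.2⟩)
    have h2 : E X ≤ E y := hmax (right_mem_Icc.2 hX)
    have := (abs_le.1 h1).2
    linarith
  have lower : ∀ X, a ≤ X → 2 / 3 * E a ≤ E X := by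
    intro X hX
    have h1 := osc X hX (4 / 3 * E a) (fun t ht => upper t ht.1)
    have := (abs_le.1 h1).1
    linarith
  -- the virial identity
  have hfu := hfa.mul hua
  set B := 4 / 3 * E a with hB
  have bfu : ∀ X, a ≤ X → |f X * u X| ≤ B + B / m := by
    intro X hX
    have h1 : u X * u X ≤ B := (hEu X hX).trans (upper X hX)
    have h2 : f X * f X ≤ B / m := by
      rw [le_div_iff₀ hm0]; linarith [hEf X hX, upper X hX]
    have := mul_self_nonneg (f X)
    have := mul_self_nonneg (u X)
    rw [abs_le]
    constructor
    · nlinarith [mul_self_nonneg (f X + u X)]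
    · nlinarith [mul_self_nonneg (f X - u X)]
  have main : ∀ X, a ≤ X → 2 / 3 * E a * (X - a) ≤
      2 * p₀ * (2 * (B + B / m)) + 8 * p₀ * lam * ∫ t in Ioi (0:ℝ), f t ^ 2 := by
    intro X hX
    have iff2 : IntervalIntegrable (fun t => f t ^ 2) volume a X :=
      (intervalIntegrable_iff_integrableOn_Ioc_of_le hX).2
        (hL2.mono_set (Ioc_subset_Ioi_self.trans (Ioi_subset_Ioi ha0)))
    have ifu := hfu.ii le_rfl hX
    have h1 := intervalIntegral.integral_mono_on (μ := volume) hX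
      (f := fun _ => 2 / 3 * E a)
      (g := fun t => 2 * p₀ * ((p t)⁻¹ * u t * u t + f t * ((q t - lam) * f t))
        + 8 * p₀ * lam * f t ^ 2) intervalIntegrable_const
        ((ifu.const_mul _).add (iff2.const_mul _)) ?_
    · rw [intervalIntegral.integral_const, intervalIntegral.integral_add (ifu.const_mul _)
        (iff2.const_mul _), intervalIntegral.integral_const_mul,
        intervalIntegral.integral_const_mul, ← hfu.sub_eq le_rfl hX, smul_eq_mul] at h1
      have h2 : ∫ t in a..X, f t ^ 2 ≤ ∫ t in Ioi (0:ℝ), f t ^ 2 := by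
        rw [intervalIntegral.integral_of_le hX]
        exact setIntegral_mono_set hL2 (Eventually.of_forall fun t => sq_nonneg (f t))
          (Ioc_subset_Ioi_self.trans (Ioi_subset_Ioi ha0)).eventuallyLE
      have h3 : f X * u X - f a * u a ≤ 2 * (B + B / m) := by
        linarith [(abs_le.1 (bfu X hX)).2, (abs_le.1 (bfu a le_rfl)).1]
      have h4 := mul_le_mul_of_nonneg_left h2 (by positivity : 0 ≤ 8 * p₀ * lam)
      have h5 := mul_le_mul_of_nonneg_left h3 (by positivity : 0 ≤ 2 * p₀)
      linarith
    · intro t ht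
      have hta := ht.1
      refine (lower t hta).trans ?_
      have hp0 := p_pos t (ha0.trans hta)
      have e1 : u t * u t ≤ 2 * p₀ * ((p t)⁻¹ * u t * u t) := by
        have : 2 * p₀ * ((p t)⁻¹ * u t * u t) = (2 * p₀ / p t) * (u t * u t) := by
          field_simp
        rw [this]
        have h1 : 1 ≤ 2 * p₀ / p t := by
          rw [le_div_iff₀ hp0]; linarith [b2 t hta]
        nlinarith [mul_self_nonneg (u t)]
      have e2 : p t * (lam - q t) ≤ 4 * p₀ * lam := by
        have := mul_le_mul (b2 t hta).le (b4 t hta).le (by linarith [b3 t hta]) (by positivity)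
        linarith
      have e3 := mul_le_mul_of_nonneg_right e2 (mul_self_nonneg (f t))
      have e4 : 2 * p₀ * (lam - q t) ≤ 4 * p₀ * lam := by
        have := mul_le_mul_of_nonneg_left (b4 t hta).le (by positivity : 0 ≤ 2 * p₀)
        linarith
      have e5 := mul_le_mul_of_nonneg_right e4 (mul_self_nonneg (f t))
      rw [hE]
      simp only
      linarith
  obtain ⟨C, hC⟩ : ∃ C, C = 2 * p₀ * (2 * (B + B / m)) +
    8 * p₀ * lam * ∫ t in Ioi (0:ℝ), f t ^ 2 := ⟨_, rfl⟩
  rw [← hC] at main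
  have h1 := main (a + (|C| + 1) / (2 / 3 * E a)) (by
    have : 0 ≤ (|C| + 1) / (2 / 3 * E a) := by positivity
    linarith)
  have h2 : 2 / 3 * E a * (a + (|C| + 1) / (2 / 3 * E a) - a) = |C| + 1 := by
    field_simp
    ring
  rw [h2] at h1
  linarith [le_abs_self C]

/-- the operator `H = −(d/dx) p (d/dx) + q` with boundary condition
`f(0) = 0` has no positive eigenvalues: if `f` solves the Schrödinger equation with
spectral parameter `λ > 0` on `[0,∞)`, `f(0) = 0`, and `f` is square integrable on
`(0,∞)`, then `f` vanishes identically on `[0,∞)`. -/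
theorem statement14 (p p' q q' : ℝ → ℝ) (p₀ x₀ : ℝ)
    (hPQ : PQData p p' q q' p₀ x₀)
    (lam : ℝ) (hlam : 0 < lam)
    (f f' : ℝ → ℂ)
    (hsol : IsSol p q (lam : ℂ) (Ici 0) f f')
    (h0 : f 0 = 0)
    (hL2 : IntegrableOn (fun x => ‖f x‖ ^ 2) (Ioi (0:ℝ))) :
    ∀ x : ℝ, 0 ≤ x → f x = 0 := by
  obtain ⟨hd, hI⟩ := hsol
  have hfc : ContinuousOn f (Ici 0) := fun x hx => (hd x hx).continuousWithinAt
  have hmeas : AEStronglyMeasurable f (volume.restrict (Ioi (0:ℝ))) :=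
    (hfc.mono Ioi_subset_Ici_self).aestronglyMeasurable measurableSet_Ioi
  have hii : ∀ x ∈ Ici (0:ℝ), ∀ y ∈ Ici (0:ℝ),
      IntervalIntegrable (fun t => ((q t : ℂ) - (lam : ℂ)) * f t) volume x y := by
    intro x hx y hy
    exact ii14 hPQ lam hfc hx hy
  have part : ∀ L : ℂ →L[ℝ] ℝ, (∀ (r : ℝ) (z : ℂ), L ((r : ℂ) * z) = r * L z) →
      (∀ z, |L z| ≤ ‖z‖) → ∀ x : ℝ, 0 ≤ x → L (f x) = 0 := by
    intro L hL hLn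
    refine real14 p p' q q' p₀ x₀ hPQ lam hlam (fun x => L (f x)) (fun x => L (f' x)) ?_ ?_ ?_
    · intro x hx
      exact L.hasFDerivAt.comp_hasDerivWithinAt x (hd x hx)
    · intro x hx y hy
      have h1 := congrArg L (hI x hx y hy)
      rw [map_sub, hL, hL, ← L.intervalIntegral_comp_comm (hii x hx y hy)] at h1
      rw [h1]
      congr 1
      funext t
      rw [← Complex.ofReal_sub, hL]
    · refine Integrable.mono' hL2 ((L.continuous.comp_aestronglyMeasurable hmeas).pow 2)
        (Eventually.of_forall fun t => ?_)
      rw [Real.norm_eq_abs, abs_pow]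
      exact pow_le_pow_left₀ (abs_nonneg _) (hLn _) 2
  intro x hx
  apply Complex.ext
  · exact part Complex.reCLM (by intro r z; simp) (fun z => Complex.abs_re_le_norm z) x hx
  · exact part Complex.imCLM (by intro r z; simp) (fun z => Complex.abs_im_le_norm z) x hx

end
end

section
/- Let z ∈ ℂ \ [0,∞), let ϱ ≥ 0, and let θ be a solution of the Schrödinger equation with spectral parameter z on [ϱ,∞) such that θ(x) ≠ 0 for all x ≥ ϱ, θ(x)/a(x,z) → 1 and θ'(x)/a(x,z) → −√(−z/p₀) as x → ∞. Define ξ(x) = θ(x)·∫_ϱ^x θ(y)⁻² p(y)⁻¹ dy for x ≥ ϱ. Then ξ solves the Schrödinger equation with spectral parameter z on [ϱ,∞), and 2√(−p₀z)·a(x,z)·ξ(x) → 1 and 2p₀·a(x,z)·ξ'(x) → 1 as x → ∞. -/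
open MeasureTheory Filter Set Complex

noncomputable section

lemma my_const_ac (c : ℂ) (a b : ℝ) : AbsolutelyContinuousOnInterval (fun _ : ℝ => c) a b :=
  (LipschitzOnWith.absolutelyContinuousOnInterval (K := 0)
    ((LipschitzWith.const c).lipschitzOnWith))

lemma my_prim_ac {f : ℝ → ℂ} {a b : ℝ} (hf : IntervalIntegrable f volume a b) :
    AbsolutelyContinuousOnInterval (fun t => ∫ s in a..t, f s) a b := by
  have h1 : IntervalIntegrable (fun t => (f t).re) volume a b := ⟨hf.1.re, hf.2.re⟩
  have h2 : IntervalIntegrable (fun t => (f t).im) volume a b := ⟨hf.1.im, hf.2.im⟩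
  have a1 := (h1.absolutelyContinuousOnInterval_intervalIntegral (c := a) (by simp))
  have a2 := (h2.absolutelyContinuousOnInterval_intervalIntegral (c := a) (by simp))
  have a3 := (a1.smul (my_const_ac 1 a b)).add (a2.smul (my_const_ac I a b))
  have key : ∀ t ∈ uIcc a b, (∫ s in a..t, f s) =
      ((∫ s in a..t, (f s).re : ℝ) : ℂ) + ((∫ s in a..t, (f s).im : ℝ) : ℂ) * I := by
    intro t ht
    have hft : IntervalIntegrable f volume a t :=
      hf.mono_set (uIcc_subset_uIcc (by simp) ht)
    have g1 : IntervalIntegrable (fun t => ((f t).re : ℂ)) volume a t := ⟨hft.1.re.ofReal, hft.2.re.ofReal⟩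
    have g2 : IntervalIntegrable (fun t => ((f t).im : ℂ)) volume a t := ⟨hft.1.im.ofReal, hft.2.im.ofReal⟩
    rw [← intervalIntegral.integral_ofReal, ← intervalIntegral.integral_ofReal,
      ← intervalIntegral.integral_mul_const, ← intervalIntegral.integral_add g1 (g2.mul_const _)]
    simp [Complex.re_add_im]
  rw [absolutelyContinuousOnInterval_iff] at a3 ⊢
  intro ε hε
  obtain ⟨δ, hδ, h⟩ := a3 ε hε
  refine ⟨δ, hδ, fun E hE hl => ?_⟩
  have := h E hE hl
  convert this using 2 with i hi
  have hm := hE.1 i hi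
  rw [key _ hm.1, key _ hm.2]
  simp

lemma my_ibp {f g : ℝ → ℂ} {a b : ℝ} (hf : IntervalIntegrable f volume a b)
    (hg : IntervalIntegrable g volume a b) (c d : ℂ) :
    ∫ t in a..b, (f t * (d + ∫ s in a..t, g s) + (c + ∫ s in a..t, f s) * g t) =
      (c + ∫ s in a..b, f s) * (d + ∫ s in a..b, g s) - c * d := by
  have aU := (my_const_ac c a b).add (my_prim_ac hf)
  have aV := (my_const_ac d a b).add (my_prim_ac hg)
  have hi : IntervalIntegrable (fun t => (f t * (d + ∫ s in a..t, g s) +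
      (c + ∫ s in a..t, f s) * g t)) volume a b :=
    (hf.mul_continuousOn aV.continuousOn).add (hg.continuousOn_mul aU.continuousOn)
  have aW := (aU.smul aV).sub (my_prim_ac hi)
  obtain ⟨C, hC⟩ := aW.const_of_ae_hasDerivAt_zero (by
    filter_upwards [hf.ae_hasDerivAt_integral, hg.ae_hasDerivAt_integral,
      hi.ae_hasDerivAt_integral] with x h1 h2 h3 hx
    have k1 := (h1 hx a (by simp)).const_add c
    have k2 := (h2 hx a (by simp)).const_add d
    have k3 := (k1.mul k2).sub (h3 hx a (by simp))
    convert! k3 using 1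
    ring)
  have e1 := hC a (by simp)
  have e2 := hC b (by simp)
  simp at e1 e2
  rw [← e1] at e2
  linear_combination -e2

lemma my_re_pos {w : ℂ} (hw : w ∈ slitPlane) : 0 < (w ^ (1 / 2 : ℂ)).re := by
  have h0 := slitPlane_ne_zero hw
  rw [cpow_def_of_ne_zero h0, Complex.exp_re]
  apply mul_pos (Real.exp_pos _)
  have h1 : (Complex.log w * (1 / 2)).im = w.arg / 2 := by
    have : (1 / 2 : ℂ) = ((1 / 2 : ℝ) : ℂ) := by norm_num
    rw [this, Complex.im_mul_ofReal, Complex.log_im]; ring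
  rw [h1]
  have := (mem_slitPlane_iff_arg.1 hw).1
  apply Real.cos_pos_of_mem_Ioo
  constructor
  · linarith [neg_pi_lt_arg w]
  · linarith [lt_of_le_of_ne (arg_le_pi w) this]

lemma my_sqrt_scale {p₀ : ℝ} (hp : 0 < p₀) {z : ℂ} (hz : z ≠ 0) :
    (-(p₀ : ℂ) * z) ^ (1 / 2 : ℂ) = p₀ * (-z / (p₀ : ℂ)) ^ (1 / 2 : ℂ) := by
  have hp' : (p₀ : ℂ) ≠ 0 := by exact_mod_cast hp.ne'
  have hw : -z / (p₀ : ℂ) ≠ 0 := div_ne_zero (neg_ne_zero.2 hz) hp'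
  have e : -(p₀ : ℂ) * z = ((p₀ ^ 2 : ℝ) : ℂ) * (-z / (p₀ : ℂ)) := by
    push_cast; field_simp
  have h2 : ((p₀ ^ 2 : ℝ) : ℂ) ≠ 0 := by exact_mod_cast (pow_pos hp 2).ne'
  rw [e, cpow_def_of_ne_zero (mul_ne_zero h2 hw), cpow_def_of_ne_zero hw,
    Complex.log_ofReal_mul (pow_pos hp 2) hw, add_mul, Complex.exp_add, Real.log_pow]
  congr 1
  have : ((((2 : ℕ) : ℝ) * Real.log p₀ : ℝ) : ℂ) * (1 / 2) = ((Real.log p₀ : ℝ) : ℂ) := by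
    push_cast; ring
  rw [this, ← Complex.ofReal_exp, Real.exp_log hp]

/-- Decay of solutions of `G' = -2κG + e`. -/
lemma my_decay {G κ e : ℝ → ℂ} {k : ℂ} {r : ℝ} (hk : 0 < k.re)
    (hG : ∀ x, r < x → HasDerivAt G (-2 * κ x * G x + e x) x)
    (hκ : Tendsto κ atTop (nhds k)) (he : Tendsto e atTop (nhds 0)) :
    Tendsto G atTop (nhds 0) := by
  set c := k.re / 2 with hc
  have hc0 : 0 < c := by positivity
  have hκ' : ∀ᶠ x in atTop, c < (κ x).re :=
    (((continuous_re.tendsto k).comp hκ).eventually (lt_mem_nhds (by simp [hc]; linarith)))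
  have key : ∀ δ > 0, ∀ᶠ x in atTop, ‖G x‖ ^ 2 ≤ δ := by
    intro δ hδ
    have he2 : Tendsto (fun x => ‖e x‖ ^ 2) atTop (nhds 0) := by
      simpa using (he.norm.pow 2)
    have he' : ∀ᶠ x in atTop, ‖e x‖ ^ 2 < 2 * c * (c * δ) :=
      he2.eventually (gt_mem_nhds (by positivity))
    obtain ⟨X, hX⟩ := ((hκ'.and he').and (eventually_gt_atTop r)).exists_forall_of_atTop
    have hD : ∀ x, X ≤ x → HasDerivAt (fun x => (‖G x‖ ^ 2 - δ / 2) * Real.exp (2 * c * x))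
        ((2 * inner ℝ (G x) (-2 * κ x * G x + e x)) * Real.exp (2 * c * x) +
          (‖G x‖ ^ 2 - δ / 2) * (Real.exp (2 * c * x) * (2 * c))) x := by
      intro x hx
      have h1 := ((hG x (hX x hx).2).norm_sq).sub_const (δ / 2)
      have h2 : HasDerivAt (fun x : ℝ => Real.exp (2 * c * x)) (Real.exp (2 * c * x) * (2 * c)) x := by
        simpa using ((hasDerivAt_id x).const_mul (2 * c)).exp
      exact h1.mul h2
    have hanti : AntitoneOn (fun x => (‖G x‖ ^ 2 - δ / 2) * Real.exp (2 * c * x)) (Ici X) := by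
      apply antitoneOn_of_deriv_nonpos (convex_Ici X)
      · exact fun x hx => (hD x hx).continuousAt.continuousWithinAt
      · intro x hx
        rw [interior_Ici] at hx
        exact (hD x (le_of_lt hx)).differentiableAt.differentiableWithinAt
      · intro x hx
        rw [interior_Ici] at hx
        rw [(hD x (le_of_lt hx)).deriv]
        obtain ⟨⟨hk1, he1⟩, -⟩ := hX x (le_of_lt hx)
        have hin : inner ℝ (G x) (-2 * κ x * G x + e x) ≤ -2 * c * ‖G x‖ ^ 2 + ‖G x‖ * ‖e x‖ := by
          rw [inner_add_right]
          have i1 : inner ℝ (G x) (-2 * κ x * G x) = -2 * (κ x).re * ‖G x‖ ^ 2 := by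
            rw [Complex.inner, ← Complex.normSq_eq_norm_sq, Complex.normSq_apply]
            simp
            ring
          have i2 := real_inner_le_norm (G x) (e x)
          rw [i1]
          nlinarith [sq_nonneg ‖G x‖]
        have hE := Real.exp_pos (2 * c * x)
        have : (2 * inner ℝ (G x) (-2 * κ x * G x + e x)) * Real.exp (2 * c * x) +
          (‖G x‖ ^ 2 - δ / 2) * (Real.exp (2 * c * x) * (2 * c)) =
          (2 * inner ℝ (G x) (-2 * κ x * G x + e x) + (‖G x‖ ^ 2 - δ / 2) * (2 * c)) *
            Real.exp (2 * c * x) := by ring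
        rw [this]
        apply mul_nonpos_of_nonpos_of_nonneg _ hE.le
        have hy : 2 * (‖G x‖ * ‖e x‖) ≤ 2 * c * ‖G x‖ ^ 2 + c * δ := by
          have h3 := sq_nonneg (2 * c * ‖G x‖ - ‖e x‖)
          have h4 : 2 * c * (2 * (‖G x‖ * ‖e x‖)) ≤ 2 * c * (2 * c * ‖G x‖ ^ 2 + c * δ) := by
            nlinarith
          exact le_of_mul_le_mul_left h4 (by positivity)
        nlinarith
    have hlim : Tendsto (fun x => (‖G X‖ ^ 2 - δ / 2) * Real.exp (2 * c * X) *
        Real.exp (-(2 * c * x))) atTop (nhds 0) := by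
      have : Tendsto (fun x : ℝ => Real.exp (-(2 * c * x))) atTop (nhds 0) :=
        Real.tendsto_exp_neg_atTop_nhds_zero.comp
          (tendsto_id.const_mul_atTop (show 0 < 2 * c by positivity))
      simpa using this.const_mul ((‖G X‖ ^ 2 - δ / 2) * Real.exp (2 * c * X))
    filter_upwards [eventually_ge_atTop X, hlim.eventually (gt_mem_nhds (half_pos hδ))] with x hx h1
    have h2 := hanti (mem_Ici.2 le_rfl) (mem_Ici.2 hx) hx
    simp only at h2
    have hE := Real.exp_pos (-(2 * c * x))
    have h3 := mul_le_mul_of_nonneg_right h2 hE.le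
    rw [mul_assoc, ← Real.exp_add, add_neg_cancel, Real.exp_zero] at h3
    linarith
  rw [Metric.tendsto_atTop]
  intro ε hε
  obtain ⟨N, hN⟩ := (key (ε ^ 2 / 2) (by positivity)).exists_forall_of_atTop
  refine ⟨N, fun x hx => ?_⟩
  rw [dist_zero_right]
  have := hN x hx
  apply lt_of_pow_lt_pow_left₀ 2 hε.le
  have : 0 < ε ^ 2 := by positivity
  linarith

lemma my_limit {F κ b : ℝ → ℂ} {k b0 : ℂ} {r : ℝ} (hk : 0 < k.re)
    (hF : ∀ x, r < x → HasDerivAt F (-2 * κ x * F x + b x) x)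
    (hκ : Tendsto κ atTop (nhds k)) (hb : Tendsto b atTop (nhds b0)) :
    Tendsto F atTop (nhds (b0 / (2 * k))) := by
  have hk0 : k ≠ 0 := by rintro rfl; simp at hk
  have := my_decay (G := fun x => F x - b0 / (2 * k)) (κ := κ)
    (e := fun x => b x - b0 / k * κ x) (r := r) hk (fun x hx => by
      convert! (hF x hx).sub_const (b0 / (2 * k)) using 1
      field_simp
      ring) hκ (by
      have := hb.sub (hκ.const_mul (b0 / k))
      simpa [hk0] using this)
  simpa using this.add_const (b0 / (2 * k))

lemma my_cont_prim {f g : ℝ → ℝ} {a : ℝ} (hac : ∀ x, a ≤ x → f x = f a + ∫ t in a..x, g t)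
    (hg : IntegrableOn g (Ioi a)) : ContinuousOn f (Ici a) := by
  have hg' : IntegrableOn g (Ici a) := by rwa [integrableOn_Ici_iff_integrableOn_Ioi]
  intro x hx
  have hx' : a ≤ x := hx
  have h1 : ContinuousOn (fun x => f a + ∫ t in a..x, g t) (Icc a (x + 1)) := by
    have := intervalIntegral.continuousOn_primitive_interval (a := a) (b := x + 1) (f := g)
      (μ := volume) (hg'.mono_set (by rw [uIcc_of_le (by linarith)]; exact Icc_subset_Ici_self))
    rw [uIcc_of_le (by linarith)] at this
    exact continuousOn_const.add this
  have h2 : ContinuousOn f (Icc a (x + 1)) := h1.congr (fun t ht => hac t ht.1)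
  refine (h2 x ⟨hx', by linarith⟩).mono_of_mem_nhdsWithin ?_
  rw [← Ici_inter_Iic]
  exact inter_mem_nhdsWithin _ (Iic_mem_nhds (by linarith))

lemma my_q_int {p p' q q' : ℝ → ℝ} {p₀ x₀ : ℝ} (hPQ : PQData p p' q q' p₀ x₀) {x y : ℝ}
    (hx : 0 ≤ x) (hy : 0 ≤ y) : IntervalIntegrable q volume x y := by
  have hc := my_cont_prim hPQ.q_ac hPQ.q'_int
  have h0 : IntervalIntegrable q volume 0 x₀ := by
    rw [intervalIntegrable_iff_integrableOn_Ioo_of_le hPQ.hx₀]; exact hPQ.q_int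
  have h1 : ∀ M, x₀ ≤ M → IntervalIntegrable q volume 0 M := fun M hM =>
    h0.trans ((hc.mono (by rw [uIcc_of_le hM]; exact Icc_subset_Ici_self)).intervalIntegrable)
  refine (h1 (max x₀ (max x y)) (le_max_left _ _)).mono_set ?_
  apply uIcc_subset_uIcc
  · rw [uIcc_of_le (le_trans hx (by simp))]; exact ⟨hx, by simp⟩
  · rw [uIcc_of_le (le_trans hx (by simp))]; exact ⟨hy, by simp⟩

/-- the exponentially growing solution. If `θ` solves the Schrödinger
equation on `[ϱ,∞)`, does not vanish there, and `θ/a → 1`, `θ'/a → −√(−z/p₀)` at `+∞`,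
then `ξ(x) = θ(x)∫_ϱ^x θ⁻²p⁻¹` solves the same equation on `[ϱ,∞)` and
`2√(−p₀z) a ξ → 1`, `2p₀ a ξ' → 1` as `x → ∞`. -/
theorem statement15 (p p' q q' : ℝ → ℝ) (p₀ x₀ : ℝ)
    (hPQ : PQData p p' q q' p₀ x₀)
    (z : ℂ) (hz : ∀ t : ℝ, 0 ≤ t → (t : ℂ) ≠ z)
    (ϱ : ℝ) (hϱ : 0 ≤ ϱ)
    (θ θ' : ℝ → ℂ)
    (hsol : IsSol p q z (Ici ϱ) θ θ')
    (hne : ∀ x : ℝ, ϱ ≤ x → θ x ≠ 0)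
    (hl : Tendsto (fun x => θ x / aa p q z x) atTop (nhds 1))
    (hl' : Tendsto (fun x => θ' x / aa p q z x) atTop
      (nhds (-((-z / (p₀ : ℂ)) ^ (1 / 2 : ℂ))))) :
    IsSol p q z (Ici ϱ) (xiFun p θ ϱ) (xiFun' p θ θ' ϱ) ∧
      Tendsto (fun x => 2 * ((-(p₀ : ℂ) * z) ^ (1 / 2 : ℂ)) * aa p q z x * xiFun p θ ϱ x)
        atTop (nhds 1) ∧
      Tendsto (fun x => 2 * (p₀ : ℂ) * aa p q z x * xiFun' p θ θ' ϱ x)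
        atTop (nhds 1) := by
  have hp0 : (p₀ : ℂ) ≠ 0 := by exact_mod_cast hPQ.hp₀.ne'
  have hz0 : z ≠ 0 := fun h => hz 0 le_rfl (by simp [h])
  have hpne : ∀ x, ϱ ≤ x → (p x : ℂ) ≠ 0 := fun x hx => by
    exact_mod_cast (hPQ.p_pos x (hϱ.trans hx)).ne'
  have hpc : ContinuousOn p (Ici ϱ) :=
    (my_cont_prim hPQ.p_ac hPQ.p'_int).mono (Ici_subset_Ici.2 hϱ)
  have hpcC : ContinuousOn (fun x => (p x : ℂ)) (Ici ϱ) :=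
    Complex.continuous_ofReal.comp_continuousOn hpc
  have hθc : ContinuousOn θ (Ici ϱ) := fun x hx => (hsol.1 x hx).continuousWithinAt
  set g : ℝ → ℂ := fun y => (θ y ^ 2)⁻¹ * ((p y : ℂ))⁻¹ with hg
  have hgc : ContinuousOn g (Ici ϱ) :=
    ((hθc.pow 2).inv₀ (fun x hx => pow_ne_zero 2 (hne x hx))).mul
      (hpcC.inv₀ (fun x hx => hpne x hx))
  have hsub : ∀ x ∈ Ici ϱ, ∀ y ∈ Ici ϱ, uIcc x y ⊆ Ici ϱ := fun x hx y hy =>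
    (ordConnected_Ici).uIcc_subset hx hy
  have hgi : ∀ x ∈ Ici ϱ, ∀ y ∈ Ici ϱ, IntervalIntegrable g volume x y := fun x hx y hy =>
    (hgc.mono (hsub x hx y hy)).intervalIntegrable
  set J : ℝ → ℂ := fun x => ∫ y in ϱ..x, g y with hJ
  have hJd : ∀ x ∈ Ici ϱ, HasDerivWithinAt J (g x) (Ici ϱ) x := by
    intro x hx
    have hx' : ϱ ≤ x := hx
    have hF : ContinuousOn (fun t => g (max ϱ t)) univ :=
      hgc.comp (by fun_prop) (fun t _ => mem_Ici.2 (le_max_left _ _))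
    have hF' : Continuous (fun t => g (max ϱ t)) := by simpa [← continuousOn_univ] using hF
    have h1 := (hF'.integral_hasStrictDerivAt ϱ x).hasDerivAt.hasDerivWithinAt (s := Ici ϱ)
    rw [max_eq_right hx'] at h1
    refine h1.congr (fun y hy => ?_) ?_
    · apply intervalIntegral.integral_congr
      intro t ht
      have : ϱ ≤ t := hsub ϱ self_mem_Ici y hy ht
      simp [max_eq_right this]
    · apply intervalIntegral.integral_congr
      intro t ht
      have : ϱ ≤ t := hsub ϱ self_mem_Ici x hx ht
      simp [max_eq_right this]
  have hxi : xiFun p θ ϱ = fun x => θ x * J x := rfl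
  have hxi' : xiFun' p θ θ' ϱ = fun x => θ' x * J x + (θ x)⁻¹ * ((p x : ℂ))⁻¹ := rfl
  have hfi : ∀ x ∈ Ici ϱ, ∀ y ∈ Ici ϱ,
      IntervalIntegrable (fun t => ((q t : ℂ) - z) * θ t) volume x y := by
    intro x hx y hy
    have h1 := my_q_int hPQ (hϱ.trans hx) (hϱ.trans hy)
    have h2 : IntervalIntegrable (fun t => (q t : ℂ)) volume x y := ⟨h1.1.ofReal, h1.2.ofReal⟩
    exact (h2.sub (intervalIntegrable_const)).mul_continuousOn (hθc.mono (hsub x hx y hy))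
  refine ⟨⟨?_, ?_⟩, ?_⟩
  · intro x hx
    rw [hxi, hxi']
    convert! (hsol.1 x hx).mul (hJd x hx) using 1
    have := hne x hx
    have := hpne x hx
    simp only [hg]
    field_simp
  · intro x hx y hy
    have hu : ∀ t ∈ uIcc x y, (p x : ℂ) * θ' x + ∫ s in x..t, ((q s : ℂ) - z) * θ s =
        p t * θ' t := by
      intro t ht
      rw [← hsol.2 x hx t (hsub x hx y hy ht)]; ring
    have hv : ∀ t ∈ uIcc x y, J x + ∫ s in x..t, g s = J t := by
      intro t ht
      exact intervalIntegral.integral_add_adjacent_intervals (hgi _ self_mem_Ici _ hx)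
        (hgi _ hx _ (hsub x hx y hy ht))
    have h1 := my_ibp (hfi x hx y hy) (hgi x hx y hy) ((p x : ℂ) * θ' x) (J x)
    rw [hu y right_mem_uIcc, hv y right_mem_uIcc] at h1
    have hpθ : ContinuousOn (fun t => (p t : ℂ) * θ' t) (uIcc x y) := by
      have := (my_const_ac ((p x : ℂ) * θ' x) x y).continuousOn.add
        (my_prim_ac (hfi x hx y hy)).continuousOn
      exact this.congr (fun t ht => (hu t ht).symm)
    have hi1 : IntervalIntegrable (fun t => ((q t : ℂ) - z) * θ t * J t) volume x y :=
      (hfi x hx y hy).mul_continuousOn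
        (fun t ht => ((hJd t (hsub x hx y hy ht)).continuousWithinAt).mono (hsub x hx y hy))
    have hi2 : IntervalIntegrable (fun t => (p t : ℂ) * θ' t * g t) volume x y :=
      (hpθ.mul (hgc.mono (hsub x hx y hy))).intervalIntegrable
    have h2 : ∫ t in x..y, (((q t : ℂ) - z) * θ t * (J x + ∫ s in x..t, g s) +
        ((p x : ℂ) * θ' x + ∫ s in x..t, ((q s : ℂ) - z) * θ s) * g t) =
        ∫ t in x..y, (((q t : ℂ) - z) * θ t * J t + (p t : ℂ) * θ' t * g t) := by
      apply intervalIntegral.integral_congr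
      intro t ht
      simp only
      rw [hu t ht, hv t ht]
    rw [h2, intervalIntegral.integral_add hi1 hi2] at h1
    have h3 : ∫ t in x..y, (p t : ℂ) * θ' t * g t = -(θ y)⁻¹ - -(θ x)⁻¹ := by
      apply intervalIntegral.integral_eq_sub_of_hasDeriv_right (f := fun t => -(θ t)⁻¹) _ _ hi2
      · exact ((hθc.mono (hsub x hx y hy)).inv₀
          (fun t ht => hne t (hsub x hx y hy ht))).neg
      · intro t ht
        have htr : t ∈ Ici ϱ := hsub x hx y hy ⟨ht.1.le, ht.2.le⟩
        have htr' : ϱ ≤ t := htr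
        have hd := ((hsol.1 t htr).inv (hne t htr)).neg.mono
          (show Ioi t ⊆ Ici ϱ from fun s hs => htr'.trans (le_of_lt hs))
        convert! hd using 1
        have := hne t htr
        have := hpne t htr
        simp only [hg]
        field_simp
    rw [h3] at h1
    have h4 : ∫ t in x..y, ((q t : ℂ) - z) * xiFun p θ ϱ t =
        ∫ t in x..y, ((q t : ℂ) - z) * θ t * J t := by
      apply intervalIntegral.integral_congr
      intro t ht
      simp only [hxi]; ring
    rw [h4, hxi']
    have := hpne x hx
    have := hpne y hy
    have e1 : (p y : ℂ) * (θ' y * J y + (θ y)⁻¹ * ((p y : ℂ))⁻¹) =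
      p y * θ' y * J y + (θ y)⁻¹ := by field_simp
    have e2 : (p x : ℂ) * (θ' x * J x + (θ x)⁻¹ * ((p x : ℂ))⁻¹) =
      p x * θ' x * J x + (θ x)⁻¹ := by field_simp
    simp only
    rw [e1, e2]
    linear_combination -h1
  · set k : ℂ := (-z / (p₀ : ℂ)) ^ (1 / 2 : ℂ) with hkdef
    have hsl : -z / (p₀ : ℂ) ∈ slitPlane := by
      rw [mem_slitPlane_iff]
      by_contra hcon
      push Not at hcon
      rw [Complex.div_ofReal_re, Complex.div_ofReal_im] at hcon
      have h1 : z.im = 0 := by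
        have := hcon.2
        rw [div_eq_zero_iff] at this
        rcases this with h | h
        · simpa using h
        · exact absurd h hPQ.hp₀.ne'
      have h2 : 0 ≤ z.re := by
        have := (div_le_iff₀ hPQ.hp₀).1 hcon.1
        simp at this; exact this
      exact hz z.re h2 (Complex.ext (by simp) (by simp [h1]))
    have hk : 0 < k.re := my_re_pos hsl
    have hk0 : k ≠ 0 := by intro h; rw [h] at hk; simp at hk
    have hane : ∀ x, aa p q z x ≠ 0 := fun x => Complex.exp_ne_zero _
    have hinv : Tendsto (fun x => aa p q z x / θ x) atTop (nhds 1) := by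
      simpa using hl.inv₀ one_ne_zero
    have hκ : Tendsto (fun x => -(θ' x / θ x)) atTop (nhds k) := by
      have := (hl'.mul hinv).neg
      simp only [mul_one, neg_neg] at this
      refine this.congr (fun x => ?_)
      have := hane x
      rw [div_mul_div_cancel₀ this]
    have hpl : Tendsto (fun x => ((p x : ℂ))⁻¹) atTop (nhds (p₀ : ℂ)⁻¹) :=
      ((Complex.continuous_ofReal.tendsto p₀).comp hPQ.p_lim).inv₀ hp0
    have hF := my_limit (F := fun x => J x * θ x ^ 2) (r := ϱ) hk (fun x hx => by
      have hx' : ϱ ≤ x := le_of_lt hx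
      have hn : Ici ϱ ∈ nhds x := Ici_mem_nhds hx
      have h1 := (hJd x hx').hasDerivAt hn
      have h2 := (hsol.1 x hx').hasDerivAt hn
      convert! h1.mul (h2.pow 2) using 1
      have := hne x hx'
      have := hpne x hx'
      simp only [hg, Pi.pow_apply]
      field_simp
      ring) hκ hpl
    constructor
    · have := (hinv.mul hF).const_mul (2 * (-(p₀ : ℂ) * z) ^ (1 / 2 : ℂ))
      rw [my_sqrt_scale hPQ.hp₀ hz0] at this ⊢
      rw [← hkdef] at this ⊢
      have e : 2 * (p₀ * k) * (1 * ((p₀ : ℂ)⁻¹ / (2 * k))) = 1 := by field_simp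
      rw [e] at this
      refine this.congr' ?_
      filter_upwards [eventually_ge_atTop ϱ] with x hx
      have := hne x hx
      rw [hxi]
      field_simp
    · have := (((hκ.neg.mul hinv).mul hF).add (hinv.mul hpl)).const_mul (2 * (p₀ : ℂ))
      have e : 2 * (p₀ : ℂ) * (-k * 1 * ((p₀ : ℂ)⁻¹ / (2 * k)) + 1 * (p₀ : ℂ)⁻¹) = 1 := by
        field_simp
        ring
      rw [e] at this
      refine this.congr' ?_
      filter_upwards [eventually_ge_atTop ϱ] with x hx
      have := hne x hx
      have := hpne x hx
      rw [hxi']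
      field_simp

end
end
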